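/- arXiv:2604.10274 — 2 statements merged into one kernel-verified Lean document; each statement's English description precedes it below -/
import Mathlib

section
/- Fix ι ∈ {0,1}, let π_ι ∈ Π_ι be level-optimal maximin, and let π_ῑ ∈ Π_ῑ be a proportional response to π_ι. Then (π_ι, π_ῑ) is a universal closest refinement pair: for every divergence D satisfying channel-DPI, D(π_ι‖π_ῑ) = inf{D(ρ_ι‖ρ_ῑ) : (ρ_ι, ρ_ῑ) ∈ Π_ι × Π_ῑ}. -/
/- STATEMENT 13: Universal closestness via proportional response
(Theorem `universal_closest_refinement_pair`).  The side `ι ∈ {0,1}` is formalized abstractly: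
`X` plays the role of `Ω_ι` and `Y` of `Ω_ῑ`. -/

open MeasureTheory ProbabilityTheory Filter
open scoped ENNReal NNReal

noncomputable section

structure Divergence : Type 1 where
  D : (Ω : Type) → [MeasurableSpace Ω] → Measure Ω → Measure Ω → EReal

/-- Channel data-processing inequality. -/
def Divergence.HasDPI (𝒟 : Divergence) : Prop :=
  ∀ (Ω Ω' : Type) [MeasurableSpace Ω] [MeasurableSpace Ω']
    (K : Kernel Ω Ω') [IsMarkovKernel K]
    (P Q : Measure Ω) [IsFiniteMeasure P] [IsFiniteMeasure Q],
    𝒟.D Ω' (P.bind K) (Q.bind K) ≤ 𝒟.D Ω P Q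

variable {X Y : Type} [MeasurableSpace X] [MeasurableSpace Y]

/-- Refinements of `νX` on side `X`. -/
def Plans (E : Set (X × Y)) (νX : Measure X) : Set (Measure (X × Y)) :=
  {π | IsFiniteMeasure π ∧ π Eᶜ = 0 ∧ π.map Prod.fst = νX}

/-- Refinements of `νY` on side `Y`. -/
def PlansSnd (E : Set (X × Y)) (νY : Measure Y) : Set (Measure (X × Y)) :=
  {π | IsFiniteMeasure π ∧ π Eᶜ = 0 ∧ π.map Prod.snd = νY}

/-- Capped feasible subplans at level `t`. -/
def Feas (E : Set (X × Y)) (νX : Measure X) (νY : Measure Y) (t : ℝ) :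
    Set (Measure (X × Y)) :=
  {σ | IsFiniteMeasure σ ∧ σ Eᶜ = 0 ∧ σ.map Prod.fst ≤ νX ∧
    σ.map Prod.snd ≤ (ENNReal.ofReal t) • νY}

/-- Maximal feasible mass at level `t`. -/
def Fit (E : Set (X × Y)) (νX : Measure X) (νY : Measure Y) (t : ℝ) : ℝ≥0∞ :=
  ⨆ σ ∈ Feas E νX νY t, σ Set.univ

/-- Level-optimal maximin. -/
def LevelOptMaximin (E : Set (X × Y)) (νX : Measure X) (νY : Measure Y)
    (π : Measure (X × Y)) : Prop :=
  ∀ t : ℝ, 0 < t →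
    ∫⁻ y, min ((π.map Prod.snd).rnDeriv νY y) (ENNReal.ofReal t) ∂νY = Fit E νX νY t

/-- `η ⋈ L`: the plan on `X × Y` built from a measure `η` on `Y` and a kernel `L : Y ⤳ X`. -/
def mix (η : Measure Y) (L : Kernel Y X) : Measure (X × Y) :=
  η.bind (fun y => (L y).map (fun x => (x, y)))

/-- `π'` is a proportional response to the side-`X` refinement `π`. -/
def IsPropResponse (E : Set (X × Y)) (νY : Measure Y) (π π' : Measure (X × Y)) : Prop :=
  ∃ K : Kernel Y X, IsFiniteKernel K ∧
    ∃ Kfb : Kernel Y X, IsMarkovKernel Kfb ∧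
      π = mix (π.map Prod.snd) K ∧
      (∀ᵐ y ∂(νY.singularPart (π.map Prod.snd)), Kfb y {x | (x, y) ∈ E} = 1) ∧
      π' = mix ((π.map Prod.snd).withDensity (νY.rnDeriv (π.map Prod.snd))) K
            + mix (νY.singularPart (π.map Prod.snd)) Kfb

section UnitInterval

open scoped unitInterval

lemma integrable_comp_coe_unitInterval (μ : Measure I) [IsFiniteMeasure μ] {F : ℝ → ℝ}
    (hF : Continuous F) : Integrable (fun x : I => F x) μ :=
  (hF.comp continuous_subtype_val).integrable_of_hasCompactSupport
    (HasCompactSupport.of_compactSpace _)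

/-- Piecewise linear interpolation of a midpoint convex Lipschitz function on a uniform grid,
built from hinge functions. -/
lemma exists_interpolation_integral_le {μ ν : Measure I} [IsFiniteMeasure μ] [IsFiniteMeasure ν]
    (hmass : μ.real Set.univ = ν.real Set.univ)
    (hmean : ∫ x, (x : ℝ) ∂μ = ∫ x, (x : ℝ) ∂ν)
    (hhinge : ∀ s : ℝ, 0 < s → s < 1 →
      ∫ x : I, max ((x : ℝ) - s) 0 ∂ν ≤ ∫ x : I, max ((x : ℝ) - s) 0 ∂μ)
    {C : ℝ → ℝ} {L : ℝ} (hLip : ∀ x y, |C x - C y| ≤ L * |x - y|)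
    (hmid : ∀ x d, 2 * C x ≤ C (x - d) + C (x + d)) {δ : ℝ} (hδ : 0 < δ) (j : ℕ)
    (hj : j * δ < 1) :
    ∃ F : ℝ → ℝ, Continuous F ∧ ∫ x : I, F x ∂ν ≤ ∫ x : I, F x ∂μ ∧
      (∀ x, 0 ≤ x → x ≤ (j + 1) * δ → |F x - C x| ≤ 2 * L * δ) ∧
      ∀ x, j * δ ≤ x →
        F x = C (j * δ) + (C ((j + 1) * δ) - C (j * δ)) / δ * (x - j * δ) := by
  have hclose : ∀ (i : ℕ) (x : ℝ), i * δ ≤ x → x ≤ (i + 1) * δ →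
      |C (i * δ) + (C ((i + 1) * δ) - C (i * δ)) / δ * (x - i * δ) - C x| ≤ 2 * L * δ := by
    intro i x h1 h2
    have hL : 0 ≤ L := by simpa using (abs_nonneg _).trans (hLip 1 0)
    have e1 : |(C ((i + 1) * δ) - C (i * δ)) / δ * (x - i * δ)| ≤ L * δ := by
      rw [abs_mul, abs_div, abs_of_pos hδ, abs_of_nonneg (by linarith : 0 ≤ x - i * δ)]
      have h3 := hLip ((i + 1) * δ) (i * δ)
      rw [show (i + 1) * δ - i * δ = δ by ring, abs_of_pos hδ] at h3
      have h4 : |C ((i + 1) * δ) - C (i * δ)| / δ ≤ L := (div_le_iff₀ hδ).2 h3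
      exact mul_le_mul h4 (by linarith) (by linarith) hL
    have e2 : |C (i * δ) - C x| ≤ L * δ := by
      refine (hLip _ _).trans (mul_le_mul_of_nonneg_left ?_ hL)
      rw [abs_le]; constructor <;> linarith
    calc _ = |(C ((i + 1) * δ) - C (i * δ)) / δ * (x - i * δ) + (C (i * δ) - C x)| := by
          congr 1; ring
      _ ≤ _ := abs_add_le _ _
      _ ≤ _ := by linarith
  induction j with
  | zero =>
    refine ⟨fun x => C 0 + (C δ - C 0) / δ * x, by fun_prop, ?_, ?_, ?_⟩
    · have h : ∀ (ρ : Measure I) [IsFiniteMeasure ρ],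
          ∫ x : I, (C 0 + (C δ - C 0) / δ * x) ∂ρ
            = ρ.real Set.univ * C 0 + (C δ - C 0) / δ * ∫ x : I, (x : ℝ) ∂ρ := by
        intro ρ _
        rw [integral_add (integrable_const _)
          ((integrable_comp_coe_unitInterval ρ (F := fun x => x) continuous_id).const_mul _),
          integral_const_mul]
        simp
      rw [h, h, hmass, hmean]
    · intro x h1 h2
      simpa using hclose 0 x (by simpa using h1) (by simpa using h2)
    · intro x _; simp
  | succ j ih =>
    have hj0 : (j : ℝ) * δ < 1 := by push_cast at hj; linarith
    obtain ⟨F, hFc, hFi, hFa, hFl⟩ := ih hj0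
    have hs0 : 0 < ((j + 1 : ℕ) : ℝ) * δ := by positivity
    set s : ℝ := ((j + 1 : ℕ) : ℝ) * δ with hs
    have hs' : (j + 1) * δ = s := by rw [hs]; push_cast; ring
    have hs2 : (((j + 1 : ℕ) : ℝ) + 1) * δ = s + δ := by rw [hs]; ring
    have hs3 : (j : ℝ) * δ = s - δ := by rw [hs]; push_cast; ring
    rw [hs2]
    rw [hs', hs3] at hFl
    rw [hs'] at hFa
    set c : ℝ := (C (s - δ) + C (s + δ) - 2 * C s) / δ with hc
    have hc0 : 0 ≤ c := div_nonneg (by linarith [hmid s δ]) hδ.le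
    have hlin : ∀ x, s ≤ x → F x + c * max (x - s) 0 = C s + (C (s + δ) - C s) / δ * (x - s) := by
      intro x hx
      rw [hFl x (by linarith), max_eq_left (by linarith), hc]
      field_simp
      ring
    refine ⟨fun x => F x + c * max (x - s) 0, by fun_prop, ?_, ?_, hlin⟩
    · have hi : ∀ (ρ : Measure I) [IsFiniteMeasure ρ],
          ∫ x : I, (F x + c * max ((x : ℝ) - s) 0) ∂ρ
            = ∫ x : I, F x ∂ρ + c * ∫ x : I, max ((x : ℝ) - s) 0 ∂ρ := by
        intro ρ _
        rw [integral_add (integrable_comp_coe_unitInterval ρ hFc)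
          ((integrable_comp_coe_unitInterval ρ (F := fun x => max (x - s) 0)
            (by fun_prop)).const_mul _), integral_const_mul]
      rw [hi, hi]
      have := mul_le_mul_of_nonneg_left (hhinge s hs0 hj) hc0
      linarith
    · intro x h1 h2
      rcases le_total x s with h | h
      · simpa [max_eq_right (by linarith : x - s ≤ 0)] using hFa x h1 h
      · have := hclose (j + 1) x h (by rw [hs2]; exact h2)
        rw [hs2, ← hs] at this
        simpa only [hlin x h] using this

lemma integral_le_of_hinge_le {μ ν : Measure I} [IsFiniteMeasure μ] [IsFiniteMeasure ν]
    (hmass : μ.real Set.univ = ν.real Set.univ)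
    (hmean : ∫ x, (x : ℝ) ∂μ = ∫ x, (x : ℝ) ∂ν)
    (hhinge : ∀ s : ℝ, 0 < s → s < 1 →
      ∫ x : I, max ((x : ℝ) - s) 0 ∂ν ≤ ∫ x : I, max ((x : ℝ) - s) 0 ∂μ)
    {C : ℝ → ℝ} (hC : Continuous C) {L : ℝ} (hLip : ∀ x y, |C x - C y| ≤ L * |x - y|)
    (hmid : ∀ x d, 2 * C x ≤ C (x - d) + C (x + d)) :
    ∫ x : I, C x ∂ν ≤ ∫ x : I, C x ∂μ := by
  have hL : 0 ≤ L := by simpa using (abs_nonneg _).trans (hLip 1 0)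
  have key : ∀ n : ℕ, ∫ x : I, C x ∂ν
      ≤ ∫ x : I, C x ∂μ + 4 * L * μ.real Set.univ * (1 / ((n : ℝ) + 1)) := by
    intro n
    have hn : (0 : ℝ) < n + 1 := by positivity
    have hδ : (0 : ℝ) < 1 / ((n : ℝ) + 1) := by positivity
    obtain ⟨F, hFc, hFi, hFa, -⟩ := exists_interpolation_integral_le hmass hmean hhinge hLip hmid
      hδ n (by rw [mul_one_div, div_lt_one hn]; linarith)
    rw [mul_one_div_cancel hn.ne'] at hFa
    set e := 2 * L * (1 / ((n : ℝ) + 1)) with he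
    have h1 : ∫ x : I, C x ∂ν ≤ ∫ x : I, (F x + e) ∂ν :=
      integral_mono (integrable_comp_coe_unitInterval ν hC)
        ((integrable_comp_coe_unitInterval ν hFc).add (integrable_const _))
        (fun x => by have := abs_le.1 (hFa x x.2.1 x.2.2); dsimp only; linarith)
    have h2 : ∫ x : I, (F x - e) ∂μ ≤ ∫ x : I, C x ∂μ :=
      integral_mono ((integrable_comp_coe_unitInterval μ hFc).sub (integrable_const _))
        (integrable_comp_coe_unitInterval μ hC)
        (fun x => by have := abs_le.1 (hFa x x.2.1 x.2.2); dsimp only; linarith)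
    rw [integral_add (integrable_comp_coe_unitInterval ν hFc) (integrable_const _)] at h1
    rw [integral_sub (integrable_comp_coe_unitInterval μ hFc) (integrable_const _)] at h2
    simp only [integral_const, smul_eq_mul] at h1 h2
    rw [← hmass] at h1
    have : 4 * L * μ.real Set.univ * (1 / ((n : ℝ) + 1)) = 2 * (μ.real Set.univ * e) := by
      rw [he]; ring
    linarith
  have hlim := (tendsto_one_div_add_atTop_nhds_zero_nat (𝕜 := ℝ)).const_mul
    (4 * L * μ.real Set.univ) |>.const_add (∫ x : I, C x ∂μ)
  rw [mul_zero, add_zero] at hlim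
  exact ge_of_tendsto' hlim key

/-- If `φ(x) + h(y) + k(y) (x - y)` is nonnegative and `μ` dominates `ν` in the convex order,
then `∫ φ dμ + ∫ h dν` is nonnegative. -/
lemma integral_add_integral_nonneg_of_hinge_le {μ ν : Measure I} [IsFiniteMeasure μ]
    [IsFiniteMeasure ν]
    (hmass : μ.real Set.univ = ν.real Set.univ)
    (hmean : ∫ x, (x : ℝ) ∂μ = ∫ x, (x : ℝ) ∂ν)
    (hhinge : ∀ s : ℝ, 0 < s → s < 1 →
      ∫ x : I, max ((x : ℝ) - s) 0 ∂ν ≤ ∫ x : I, max ((x : ℝ) - s) 0 ∂μ)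
    (φ h k : C(I, ℝ)) (hnn : ∀ x y : I, 0 ≤ φ x + h y + k y * ((x : ℝ) - y)) :
    0 ≤ ∫ x, φ x ∂μ + ∫ y, h y ∂ν := by
  set C : ℝ → ℝ := fun x => ⨆ y : I, (-h y - k y * (x - y)) with hCdef
  have hk : ∀ (y : I) (t : ℝ), |k y * t| ≤ ‖k‖ * |t| := fun y t => by
    rw [abs_mul]; exact mul_le_mul_of_nonneg_right (k.norm_coe_le_norm y) (abs_nonneg _)
  have hbdd : ∀ x : ℝ, BddAbove (Set.range fun y : I => -h y - k y * (x - y)) := fun x =>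
    (isCompact_range (by fun_prop)).bddAbove
  have hle : ∀ (x : ℝ) (y : I), -h y - k y * (x - y) ≤ C x := fun x y => le_ciSup (hbdd x) y
  have hLip1 : ∀ x y, C x ≤ C y + ‖k‖ * |x - y| := by
    intro x y
    refine ciSup_le fun z => ?_
    have h1 := hle y z
    have h2 := (abs_le.1 (hk z (x - y))).1
    linarith
  have hLip : ∀ x y, |C x - C y| ≤ ‖k‖ * |x - y| := by
    intro x y
    have h1 := hLip1 x y
    have h2 := hLip1 y x
    rw [abs_sub_comm y x] at h2
    rw [abs_le]; constructor <;> linarith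
  have hmid : ∀ x d, 2 * C x ≤ C (x - d) + C (x + d) := by
    intro x d
    have : C x ≤ (C (x - d) + C (x + d)) / 2 := ciSup_le fun z => by
      have h1 := hle (x - d) z
      have h2 := hle (x + d) z
      linarith
    linarith
  have hC : Continuous C :=
    (LipschitzWith.of_dist_le_mul (K := ⟨‖k‖, norm_nonneg _⟩) hLip).continuous
  have h1 := integral_le_of_hinge_le hmass hmean hhinge hC hLip hmid
  have h2 : ∫ x : I, C x ∂μ ≤ ∫ x, φ x ∂μ :=
    integral_mono (integrable_comp_coe_unitInterval μ hC)
      (φ.continuous.integrable_of_hasCompactSupport (HasCompactSupport.of_compactSpace _))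
      (fun x => ciSup_le fun y => by linarith [hnn x y])
  have h3 : ∫ x : I, -h x ∂ν ≤ ∫ x : I, C x ∂ν :=
    integral_mono
      (h.continuous.neg.integrable_of_hasCompactSupport (HasCompactSupport.of_compactSpace _))
      (integrable_comp_coe_unitInterval ν hC)
      (fun x => by simpa using hle x x)
  rw [integral_neg] at h3
  linarith

/-- Strassen's theorem on the unit interval: convex domination yields a martingale coupling. -/
lemma exists_martingale_coupling {μ ν : Measure I} [IsFiniteMeasure μ]
    [IsFiniteMeasure ν]
    (hmass : μ.real Set.univ = ν.real Set.univ)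
    (hmean : ∫ x, (x : ℝ) ∂μ = ∫ x, (x : ℝ) ∂ν)
    (hhinge : ∀ s : ℝ, 0 < s → s < 1 →
      ∫ x : I, max ((x : ℝ) - s) 0 ∂ν ≤ ∫ x : I, max ((x : ℝ) - s) 0 ∂μ) :
    ∃ γ : Measure (I × I), IsFiniteMeasure γ ∧
      (∀ φ : C(I, ℝ), ∫ z, φ z.1 ∂γ = ∫ x, φ x ∂μ) ∧
      (∀ h : C(I, ℝ), ∫ z, h z.2 ∂γ = ∫ y, h y ∂ν) ∧
      ∀ k : C(I, ℝ), ∫ z, k z.2 * ((z.1 : ℝ) - z.2) ∂γ = 0 := by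
  have hint : ∀ (ρ : Measure I) [IsFiniteMeasure ρ] (f : C(I, ℝ)), Integrable f ρ := fun ρ _ f =>
    f.continuous.integrable_of_hasCompactSupport (HasCompactSupport.of_compactSpace _)
  have key := integral_add_integral_nonneg_of_hinge_le hmass hmean hhinge
  let S : CompactlySupportedContinuousMap (I × I) ℝ → Set ℝ := fun f =>
    {c | ∃ φ h k : C(I, ℝ), (∀ x y : I, f (x, y) ≤ φ x + h y + k y * ((x : ℝ) - y)) ∧
      c = ∫ x, φ x ∂μ + ∫ y, h y ∂ν}
  let cc : C(I × I, ℝ) → CompactlySupportedContinuousMap (I × I) ℝ :=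
    CompactlySupportedContinuousMap.continuousMapEquiv
  have hbound : ∀ f : CompactlySupportedContinuousMap (I × I) ℝ, ∃ M, ∀ z, |f z| ≤ M := by
    intro f
    obtain ⟨M, hM⟩ := (isCompact_range f.continuous.abs).bddAbove
    exact ⟨M, fun z => hM ⟨z, rfl⟩⟩
  have hne : ∀ f, (S f).Nonempty := by
    intro f
    obtain ⟨M, hM⟩ := hbound f
    exact ⟨_, ContinuousMap.const _ M, 0, 0, fun x y => by simpa using (abs_le.1 (hM (x, y))).2,
      rfl⟩
  have hbdd : ∀ f, BddBelow (S f) := by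
    intro f
    obtain ⟨M, hM⟩ := hbound f
    refine ⟨-(μ.real Set.univ * M), ?_⟩
    rintro _ ⟨φ, h, k, hf, rfl⟩
    have h1 := key (φ + ContinuousMap.const _ M) h k (fun x y => by
      have := (abs_le.1 (hM (x, y))).1
      have := hf x y
      simp only [ContinuousMap.add_apply, ContinuousMap.const_apply]
      linarith)
    simp only [ContinuousMap.add_apply, ContinuousMap.const_apply] at h1
    rw [integral_add (hint μ φ) (integrable_const _)] at h1
    simp only [integral_const, smul_eq_mul] at h1
    linarith
  have hsmul : ∀ c : ℝ, 0 < c → ∀ f, ∀ a ∈ S f, c * a ∈ S (c • f) := by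
    rintro c hc f _ ⟨φ, h, k, hf, rfl⟩
    refine ⟨c • φ, c • h, c • k, fun x y => ?_, ?_⟩
    · have := mul_le_mul_of_nonneg_left (hf x y) hc.le
      simp only [CompactlySupportedContinuousMap.smul_apply, ContinuousMap.smul_apply,
        smul_eq_mul]
      linarith
    · simp only [ContinuousMap.smul_apply, smul_eq_mul, integral_const_mul]
      ring
  have hN_hom : ∀ c : ℝ, 0 < c → ∀ f, sInf (S (c • f)) = c * sInf (S f) := by
    intro c hc f
    apply le_antisymm
    · rw [← div_le_iff₀' hc]
      refine le_csInf (hne f) fun a ha => ?_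
      rw [div_le_iff₀' hc]
      exact csInf_le (hbdd _) (hsmul c hc f a ha)
    · refine le_csInf (hne _) fun a ha => ?_
      have h1 := hsmul c⁻¹ (inv_pos.2 hc) _ a ha
      rw [inv_smul_smul₀ hc.ne'] at h1
      have h2 := csInf_le (hbdd f) h1
      rwa [le_inv_mul_iff₀ hc] at h2
  have hN_add : ∀ f g, sInf (S (f + g)) ≤ sInf (S f) + sInf (S g) := by
    intro f g
    rw [← sub_le_iff_le_add]
    refine le_csInf (hne f) ?_
    rintro _ ⟨φ, h, k, hf, rfl⟩
    rw [sub_le_comm]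
    refine le_csInf (hne g) ?_
    rintro _ ⟨φ', h', k', hg, rfl⟩
    rw [sub_le_iff_le_add']
    refine csInf_le (hbdd _) ⟨φ + φ', h + h', k + k', fun x y => ?_, ?_⟩
    · have h1 := hf x y
      have h2 := hg x y
      simp only [CompactlySupportedContinuousMap.add_apply, ContinuousMap.add_apply]
      linarith
    · simp only [ContinuousMap.add_apply]
      rw [integral_add (hint μ φ) (hint μ φ'), integral_add (hint ν h) (hint ν h')]
      ring
  obtain ⟨Λ, -, hΛ⟩ := exists_extension_of_le_sublinear
    (⟨⊥, 0⟩ : CompactlySupportedContinuousMap (I × I) ℝ →ₗ.[ℝ] ℝ) (fun f => sInf (S f)) hN_hom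
    hN_add
    (by
      rintro ⟨x, hx⟩
      have hx0 : x = 0 := by simpa using hx
      subst hx0
      refine le_csInf (hne _) ?_
      rintro _ ⟨φ, h, k, hf, rfl⟩
      exact key φ h k (fun x y => by simpa using hf x y))
  have hΛS : ∀ f, ∀ a ∈ S f, Λ f ≤ a := fun f a ha => (hΛ f).trans (csInf_le (hbdd f) ha)
  let Λ' := PositiveLinearMap.mk₀ Λ (fun f hf => by
    have h1 := hΛS (-f) 0 ⟨0, 0, 0, fun x y => by
      have : 0 ≤ f (x, y) := hf (x, y)
      simpa using this, by simp⟩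
    rw [map_neg] at h1
    linarith)
  have hrep : ∀ f, ∫ z, f z ∂(RealRMK.rieszMeasure Λ') = Λ f := fun f =>
    RealRMK.integral_rieszMeasure Λ' f
  have hrep' : ∀ φ h k : C(I, ℝ),
      ∫ z : I × I, (φ z.1 + h z.2 + k z.2 * ((z.1 : ℝ) - z.2)) ∂(RealRMK.rieszMeasure Λ')
        = ∫ x, φ x ∂μ + ∫ y, h y ∂ν := by
    intro φ h k
    let f := cc ⟨fun z : I × I => φ z.1 + h z.2 + k z.2 * ((z.1 : ℝ) - z.2), by fun_prop⟩
    have h1 := hΛS f _ ⟨φ, h, k, fun x y => le_rfl, rfl⟩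
    have h2 := hΛS (-f) _ ⟨-φ, -h, -k, fun x y => le_of_eq (by
      change -(φ x + h y + k y * ((x : ℝ) - y)) = -φ x + -h y + -k y * ((x : ℝ) - y)
      ring), rfl⟩
    rw [map_neg] at h2
    simp only [ContinuousMap.neg_apply, integral_neg] at h2
    exact (hrep f).trans (by linarith)
  refine ⟨RealRMK.rieszMeasure Λ', inferInstance, fun φ => ?_, fun h => ?_, fun k => ?_⟩
  · simpa using hrep' φ 0 0
  · simpa using hrep' 0 h 0
  · simpa using hrep' 0 0 k

lemma integral_withDensity_ofReal {Ω : Type*} [MeasurableSpace Ω] (μ : Measure Ω)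
    {f : Ω → ℝ} (hf : Measurable f) (hf0 : ∀ ω, 0 ≤ f ω) (h : Ω → ℝ) :
    ∫ ω, h ω ∂(μ.withDensity fun ω => ENNReal.ofReal (f ω)) = ∫ ω, f ω * h ω ∂μ := by
  rw [integral_withDensity_eq_integral_toReal_smul hf.ennreal_ofReal (by simp)]
  simp [ENNReal.toReal_ofReal (hf0 _)]

lemma bind_condKernel_withDensity {A B : Type*} [MeasurableSpace A] [MeasurableSpace B]
    [StandardBorelSpace B] [Nonempty B] (γ : Measure (A × B)) [IsFiniteMeasure γ]
    {f : A → ℝ≥0∞} (hf : Measurable f) :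
    (γ.fst.withDensity f).bind γ.condKernel = (γ.withDensity fun z => f z.1).map Prod.snd := by
  ext s hs
  rw [Measure.bind_apply hs (Kernel.aemeasurable _), Measure.map_apply measurable_snd hs,
    withDensity_apply _ (measurable_snd hs), ← lintegral_indicator (measurable_snd hs),
    lintegral_withDensity_eq_lintegral_mul _ hf (Kernel.measurable_coe _ hs)]
  conv_rhs => rw [← γ.disintegrate γ.condKernel]
  have hf' : Measurable fun z : A × B => f z.1 := hf.comp measurable_fst
  rw [Measure.lintegral_compProd (hf'.indicator (measurable_snd hs))]
  refine lintegral_congr fun a => ?_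
  have : ∀ b, (Prod.snd ⁻¹' s).indicator (fun z : A × B => f z.1) (a, b)
      = s.indicator (fun _ => f a) b := fun b => rfl
  simp_rw [this]
  rw [lintegral_indicator_const hs]
  rfl

lemma exists_kernel_unitInterval {μ ν : Measure I} [IsFiniteMeasure μ] [IsFiniteMeasure ν]
    (h₁ : ∫⁻ x : I, ENNReal.ofReal x ∂μ = ∫⁻ x : I, ENNReal.ofReal x ∂ν)
    (h₀ : ∫⁻ x : I, ENNReal.ofReal (1 - x) ∂μ = ∫⁻ x : I, ENNReal.ofReal (1 - x) ∂ν)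
    (hmin : ∀ t : ℝ, 0 < t → ∫⁻ x : I, ENNReal.ofReal (min (x : ℝ) (t * (1 - x))) ∂μ
      ≤ ∫⁻ x : I, ENNReal.ofReal (min (x : ℝ) (t * (1 - x))) ∂ν) :
    ∃ κ : Kernel I I, IsMarkovKernel κ ∧
      (μ.withDensity fun x => ENNReal.ofReal x).bind κ
        = ν.withDensity (fun x => ENNReal.ofReal x) ∧
      (μ.withDensity fun x => ENNReal.ofReal (1 - x)).bind κ
        = ν.withDensity (fun x => ENNReal.ofReal (1 - x)) := by
  have hreal : ∀ (ρ : Measure I) [IsFiniteMeasure ρ] (F : ℝ → ℝ), Continuous F →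
      (∀ x : I, 0 ≤ F x) →
      ENNReal.ofReal (∫ x : I, F x ∂ρ) = ∫⁻ x : I, ENNReal.ofReal (F x) ∂ρ := by
    intro ρ _ F hF hF0
    exact ofReal_integral_eq_lintegral_ofReal (integrable_comp_coe_unitInterval ρ hF)
      (ae_of_all _ hF0)
  have hmean : ∫ x, (x : ℝ) ∂μ = ∫ x, (x : ℝ) ∂ν := by
    rw [← hreal μ (fun x => x) continuous_id (fun x => x.2.1),
      ← hreal ν (fun x => x) continuous_id (fun x => x.2.1)] at h₁
    exact (ENNReal.ofReal_eq_ofReal_iff (integral_nonneg fun x => x.2.1)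
      (integral_nonneg fun x => x.2.1)).1 h₁
  have hlin : ∀ (ρ : Measure I) [IsFiniteMeasure ρ] (F : ℝ → ℝ), Continuous F → ∀ a : ℝ,
      ∫ x : I, a * ((x : ℝ) - F x) ∂ρ = a * (∫ x : I, (x : ℝ) ∂ρ - ∫ x : I, F x ∂ρ) := by
    intro ρ _ F hF a
    rw [integral_const_mul, integral_sub
      (integrable_comp_coe_unitInterval ρ (F := fun x => x) continuous_id)
      (integrable_comp_coe_unitInterval ρ hF)]
  have hmass : μ.real Set.univ = ν.real Set.univ := by
    rw [← hreal μ (fun x => 1 - x) (by fun_prop) (fun x => by linarith [x.2.2]),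
      ← hreal ν (fun x => 1 - x) (by fun_prop) (fun x => by linarith [x.2.2]),
      ENNReal.ofReal_eq_ofReal_iff (integral_nonneg fun x => by simpa using x.2.2)
        (integral_nonneg fun x => by simpa using x.2.2)] at h₀
    have h := fun (ρ : Measure I) [IsFiniteMeasure ρ] => integral_sub (μ := ρ)
      (integrable_const (1 : ℝ))
      (integrable_comp_coe_unitInterval ρ (F := fun x => x) continuous_id)
    rw [h, h, hmean] at h₀
    simpa using h₀
  have hhinge : ∀ s : ℝ, 0 < s → s < 1 →
      ∫ x : I, max ((x : ℝ) - s) 0 ∂ν ≤ ∫ x : I, max ((x : ℝ) - s) 0 ∂μ := by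
    intro s hs0 hs1
    have hs1' : 0 < 1 - s := by linarith
    have ht : 0 < s / (1 - s) := div_pos hs0 hs1'
    have hpt : ∀ x : ℝ,
        max (x - s) 0 = (1 - s) * (x - min x (s / (1 - s) * (1 - x))) := by
      intro x
      have e : s / (1 - s) * (1 - x) = x - (x - s) / (1 - s) := by field_simp; ring
      rw [e]
      rcases le_total x s with h | h
      · rw [max_eq_right (by linarith), min_eq_left, sub_self, mul_zero]
        have : (x - s) / (1 - s) ≤ 0 := div_nonpos_of_nonpos_of_nonneg (by linarith) hs1'.le
        linarith
      · rw [max_eq_left (by linarith), min_eq_right]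
        · field_simp; ring
        · have : 0 ≤ (x - s) / (1 - s) := div_nonneg (by linarith) hs1'.le
          linarith
    have hpos : ∀ x : I, 0 ≤ min (x : ℝ) (s / (1 - s) * (1 - x)) := fun x =>
      le_min x.2.1 (mul_nonneg ht.le (by linarith [x.2.2]))
    have hc : Continuous fun x : ℝ => min x (s / (1 - s) * (1 - x)) := by fun_prop
    have h := hmin _ ht
    rw [← hreal μ _ hc hpos, ← hreal ν _ hc hpos,
      ENNReal.ofReal_le_ofReal_iff (integral_nonneg hpos)] at h
    simp_rw [hpt]
    rw [hlin ν _ hc, hlin μ _ hc, hmean]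
    exact mul_le_mul_of_nonneg_left (by linarith) hs1'.le
  obtain ⟨γ, hγ, hfst, hsnd, hmart⟩ := exists_martingale_coupling hmass hmean hhinge
  have hfst' : γ.fst = μ := by
    refine ext_of_forall_integral_eq_of_IsFiniteMeasure fun f => ?_
    rw [Measure.fst, integral_map measurable_fst.aemeasurable
      f.continuous.aestronglyMeasurable]
    exact hfst f.toContinuousMap
  have hdens : ∀ a b : ℝ, (∀ x : I, 0 ≤ a + b * (x : ℝ)) →
      (μ.withDensity fun x : I => ENNReal.ofReal (a + b * x)).bind γ.condKernel
        = ν.withDensity (fun x : I => ENNReal.ofReal (a + b * x)) := by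
    intro a b hab
    have hm : Measurable fun x : I => a + b * (x : ℝ) := by fun_prop
    have hm' : Measurable fun z : I × I => a + b * (z.1 : ℝ) := by fun_prop
    rw [← hfst', bind_condKernel_withDensity γ hm.ennreal_ofReal]
    have hfin : ∀ {Ω : Type} [MeasurableSpace Ω] (ρ : Measure Ω) [IsFiniteMeasure ρ] (g : Ω → I),
        IsFiniteMeasure (ρ.withDensity fun ω => ENNReal.ofReal (a + b * (g ω : ℝ))) := by
      intro Ω _ ρ _ g
      refine isFiniteMeasure_withDensity (ne_top_of_le_ne_top
        (b := ∫⁻ _, ENNReal.ofReal (|a| + |b|) ∂ρ) (by simp [ENNReal.mul_eq_top])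
        (lintegral_mono fun ω => ENNReal.ofReal_le_ofReal ?_))
      have h1 : b * (g ω : ℝ) ≤ |b| * 1 :=
        (mul_le_mul_of_nonneg_right (le_abs_self b) (g ω).2.1).trans
          (mul_le_mul_of_nonneg_left (g ω).2.2 (abs_nonneg b))
      linarith [le_abs_self a]
    have := hfin γ Prod.fst
    have := hfin ν id
    dsimp only [id] at this
    refine ext_of_forall_integral_eq_of_IsFiniteMeasure fun f => ?_
    rw [integral_map measurable_snd.aemeasurable f.continuous.aestronglyMeasurable,
      integral_withDensity_ofReal γ hm' (fun z => hab z.1),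
      integral_withDensity_ofReal ν hm hab]
    have hint : ∀ g : I × I → ℝ, Continuous g → Integrable g γ := fun g hg =>
      hg.integrable_of_hasCompactSupport (HasCompactSupport.of_compactSpace _)
    have e1 := hsnd ⟨fun y => (a + b * (y : ℝ)) * f y, by fun_prop⟩
    have e2 := hmart f.toContinuousMap
    simp only [ContinuousMap.coe_mk] at e1
    calc ∫ z : I × I, (a + b * (z.1 : ℝ)) * f z.2 ∂γ
        = ∫ z : I × I, ((a + b * (z.2 : ℝ)) * f z.2
            + b * (f.toContinuousMap z.2 * ((z.1 : ℝ) - z.2))) ∂γ := by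
          refine integral_congr_ae (ae_of_all _ fun z => ?_)
          change (a + b * (z.1 : ℝ)) * f z.2
            = (a + b * (z.2 : ℝ)) * f z.2 + b * (f z.2 * ((z.1 : ℝ) - z.2))
          ring
      _ = _ := by
          rw [integral_add (hint _ (by fun_prop)) (hint _ (by fun_prop)), integral_const_mul, e1,
            e2, mul_zero, add_zero]
  refine ⟨γ.condKernel, inferInstance, ?_, ?_⟩
  · simpa using hdens 0 1 (fun x => by simpa using x.2.1)
  · simpa [← sub_eq_add_neg] using hdens 1 (-1) (fun x => by simpa using x.2.2)

lemma exists_density_unitInterval {Ω : Type*} [MeasurableSpace Ω] (P Q : Measure Ω)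
    [IsFiniteMeasure P] [IsFiniteMeasure Q] :
    ∃ p : Ω → I, Measurable p ∧
      (P + Q).withDensity (fun ω => ENNReal.ofReal (p ω)) = P ∧
      (P + Q).withDensity (fun ω => ENNReal.ofReal (1 - p ω)) = Q := by
  have hle : P ≤ P + Q := Measure.le_add_right le_rfl
  let p : Ω → I := fun ω => Set.projIcc 0 1 zero_le_one (P.rnDeriv (P + Q) ω).toReal
  have hp : Measurable p :=
    continuous_projIcc.measurable.comp (Measure.measurable_rnDeriv P (P + Q)).ennreal_toReal
  have hP : (P + Q).withDensity (fun ω => ENNReal.ofReal (p ω)) = P := by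
    conv_rhs =>
      rw [← Measure.withDensity_rnDeriv_eq P (P + Q) (Measure.absolutelyContinuous_of_le hle)]
    refine withDensity_congr_ae ?_
    filter_upwards [Measure.rnDeriv_le_one_of_le hle] with ω hω
    have h1 : (P.rnDeriv (P + Q) ω).toReal ≤ 1 :=
      ENNReal.toReal_le_of_le_ofReal zero_le_one (by simpa using hω)
    have h2 : ((p ω : I) : ℝ) = (P.rnDeriv (P + Q) ω).toReal := by
      simp only [p]
      rw [Set.projIcc_of_mem _ ⟨ENNReal.toReal_nonneg, h1⟩]
    rw [h2, ENNReal.ofReal_toReal (ne_top_of_le_ne_top ENNReal.one_ne_top hω)]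
  refine ⟨p, hp, hP, ?_⟩
  have hsum : (P + Q).withDensity (fun ω => ENNReal.ofReal (p ω))
      + (P + Q).withDensity (fun ω => ENNReal.ofReal (1 - p ω)) = P + Q := by
    rw [← withDensity_add_left hp.subtype_val.ennreal_ofReal]
    conv_rhs => rw [← withDensity_one (μ := P + Q)]
    congr 1
    funext ω
    rw [Pi.add_apply, ← ENNReal.ofReal_add (p ω).2.1 (by linarith [(p ω).2.2])]
    simp
  rw [hP] at hsum
  ext s hs
  have h := congrArg (fun m => m s) hsum
  simp only [Measure.add_apply] at h
  exact (ENNReal.add_right_inj (measure_ne_top P s)).1 h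

lemma measure_univ_le_lintegral_min {Ω : Type*} [MeasurableSpace Ω] {μ τ : Measure Ω}
    {f g : Ω → ℝ≥0∞} (hf : Measurable f) (hg : Measurable g)
    (hτf : τ ≤ μ.withDensity f) (hτg : τ ≤ μ.withDensity g) :
    τ Set.univ ≤ ∫⁻ ω, min (f ω) (g ω) ∂μ := by
  have hS : MeasurableSet {ω | f ω ≤ g ω} := measurableSet_le hf hg
  rw [← measure_add_measure_compl hS, ← lintegral_add_compl _ hS]
  refine add_le_add ?_ ?_
  · refine (hτf _).trans_eq ?_
    rw [withDensity_apply _ hS]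
    exact setLIntegral_congr_fun hS fun ω hω => (min_eq_left hω).symm
  · refine (hτg _).trans_eq ?_
    rw [withDensity_apply _ hS.compl]
    exact setLIntegral_congr_fun hS.compl fun ω hω =>
      (min_eq_right (not_le.1 (show ¬f ω ≤ g ω from hω)).le).symm

lemma map_withDensity_comp {Ω Ω' : Type*} [MeasurableSpace Ω] [MeasurableSpace Ω'] (μ : Measure Ω)
    {p : Ω → Ω'} (hp : Measurable p) {f : Ω' → ℝ≥0∞} (hf : Measurable f) :
    (μ.withDensity fun ω => f (p ω)).map p = (μ.map p).withDensity f := by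
  ext s hs
  rw [Measure.map_apply hp hs, withDensity_apply _ (hp hs), withDensity_apply _ hs,
    setLIntegral_map hs hf hp]

lemma ofReal_smul_withDensity_ofReal {Ω : Type*} [MeasurableSpace Ω] (μ : Measure Ω)
    {f : Ω → ℝ} (hf : Measurable f) {t : ℝ} (ht : 0 ≤ t) :
    ENNReal.ofReal t • μ.withDensity (fun ω => ENNReal.ofReal (f ω))
      = μ.withDensity (fun ω => ENNReal.ofReal (t * f ω)) := by
  rw [← withDensity_smul _ hf.ennreal_ofReal]
  congr 1
  funext ω
  rw [Pi.smul_apply, smul_eq_mul, ← ENNReal.ofReal_mul ht]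

/-- Blackwell's theorem for dichotomies: if at every level `t` the common part of `P₁` and `t Q₁`
is no larger than that of `P₂` and `t Q₂`, then some Markov kernel maps `(P₁, Q₁)` to `(P₂, Q₂)`. -/
theorem exists_kernel_of_common_part_le {Ω₁ Ω₂ : Type*} [MeasurableSpace Ω₁] [MeasurableSpace Ω₂]
    [StandardBorelSpace Ω₂] [Nonempty Ω₂] (P₁ Q₁ : Measure Ω₁) (P₂ Q₂ : Measure Ω₂)
    [IsFiniteMeasure P₁] [IsFiniteMeasure Q₁] [IsFiniteMeasure P₂] [IsFiniteMeasure Q₂]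
    (hP : P₁ Set.univ = P₂ Set.univ) (hQ : Q₁ Set.univ = Q₂ Set.univ)
    (h : ∀ t : ℝ, 0 < t → ∀ η ≤ P₁, η ≤ ENNReal.ofReal t • Q₁ →
      ∃ τ ≤ P₂, τ ≤ ENNReal.ofReal t • Q₂ ∧ η Set.univ ≤ τ Set.univ) :
    ∃ K : Kernel Ω₁ Ω₂, IsMarkovKernel K ∧ P₁.bind K = P₂ ∧ Q₁.bind K = Q₂ := by
  obtain ⟨p₁, hp₁, hP₁, hQ₁⟩ := exists_density_unitInterval P₁ Q₁
  obtain ⟨p₂, hp₂, hP₂, hQ₂⟩ := exists_density_unitInterval P₂ Q₂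
  set μ₁ := P₁ + Q₁
  set μ₂ := P₂ + Q₂
  have hf : Measurable fun x : I => ENNReal.ofReal x := by fun_prop
  have hg : Measurable fun x : I => ENNReal.ofReal (1 - x) := by fun_prop
  obtain ⟨κ, hκ, hκP, hκQ⟩ := exists_kernel_unitInterval (μ := μ₁.map p₁) (ν := μ₂.map p₂)
    (by
      rw [lintegral_map hf hp₁, lintegral_map hf hp₂, ← setLIntegral_univ,
        ← setLIntegral_univ (μ := μ₂), ← withDensity_apply _ MeasurableSet.univ,
        ← withDensity_apply _ MeasurableSet.univ, hP₁, hP₂, hP])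
    (by
      rw [lintegral_map hg hp₁, lintegral_map hg hp₂, ← setLIntegral_univ,
        ← setLIntegral_univ (μ := μ₂), ← withDensity_apply _ MeasurableSet.univ,
        ← withDensity_apply _ MeasurableSet.univ, hQ₁, hQ₂, hQ])
    (by
      intro t ht
      have hm : Measurable fun x : I => ENNReal.ofReal (min (x : ℝ) (t * (1 - x))) := by fun_prop
      rw [lintegral_map hm hp₁, lintegral_map hm hp₂]
      obtain ⟨τ, hτP, hτQ, hτ⟩ := h t ht
        (μ₁.withDensity fun ω => ENNReal.ofReal (min (p₁ ω : ℝ) (t * (1 - p₁ ω))))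
        (by
          conv_rhs => rw [← hP₁]
          exact withDensity_mono (ae_of_all _ fun ω =>
            ENNReal.ofReal_le_ofReal (min_le_left _ _)))
        (by
          conv_rhs => rw [← hQ₁, ofReal_smul_withDensity_ofReal μ₁ (by fun_prop) ht.le]
          exact withDensity_mono (ae_of_all _ fun ω =>
            ENNReal.ofReal_le_ofReal (min_le_right _ _)))
      rw [withDensity_apply _ MeasurableSet.univ, setLIntegral_univ] at hτ
      rw [← hP₂] at hτP
      rw [← hQ₂, ofReal_smul_withDensity_ofReal μ₂ (by fun_prop) ht.le] at hτQ
      refine hτ.trans ((measure_univ_le_lintegral_min (by fun_prop) (by fun_prop)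
        hτP hτQ).trans_eq ?_)
      simp_rw [ENNReal.ofReal_min])
  have hγ : Measurable fun ω => (p₂ ω, ω) := hp₂.prodMk measurable_id
  let γ : Measure (I × Ω₂) := μ₂.map fun ω => (p₂ ω, ω)
  have hγfst : γ.fst = μ₂.map p₂ := Measure.fst_map_prodMk measurable_id
  have hback : ∀ f : I → ℝ≥0∞, Measurable f →
      ((μ₂.map p₂).withDensity f).bind γ.condKernel = μ₂.withDensity fun ω => f (p₂ ω) := by
    intro f hf
    have hf' : Measurable fun z : I × Ω₂ => f z.1 := hf.comp measurable_fst
    rw [← hγfst, bind_condKernel_withDensity γ hf]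
    ext s hs
    rw [Measure.map_apply measurable_snd hs, withDensity_apply _ (measurable_snd hs),
      setLIntegral_map (measurable_snd hs) hf' hγ, withDensity_apply _ hs]
    rfl
  refine ⟨γ.condKernel ∘ₖ (κ ∘ₖ Kernel.deterministic p₁ hp₁), inferInstance, ?_, ?_⟩
  · rw [← Measure.comp_assoc, ← Measure.comp_assoc, Measure.deterministic_comp_eq_map, ← hP₁,
      map_withDensity_comp μ₁ hp₁ hf, hκP, hback _ hf, hP₂]
  · rw [← Measure.comp_assoc, ← Measure.comp_assoc, Measure.deterministic_comp_eq_map, ← hQ₁,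
      map_withDensity_comp μ₁ hp₁ hg, hκQ, hback _ hg, hQ₂]

end UnitInterval

lemma mix_eq_bind_prod_id {X Y : Type} [MeasurableSpace X] [MeasurableSpace Y] (η : Measure Y)
    (L : Kernel Y X) [IsFiniteKernel L] : mix η L = η.bind (L ×ₖ Kernel.id) := by
  unfold mix
  congr 1
  funext y
  rw [Kernel.prod_apply, Kernel.id_apply, Measure.prod_dirac]

/-- A proportional response is obtained from the opposite marginals by a single Markov kernel. -/
lemma IsPropResponse.exists_kernel {X Y : Type} [MeasurableSpace X] [MeasurableSpace Y]
    {E : Set (X × Y)} {νY : Measure Y} [IsFiniteMeasure νY] {π π' : Measure (X × Y)}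
    [IsFiniteMeasure π] (h : IsPropResponse E νY π π') :
    ∃ κ : Kernel Y (X × Y), IsMarkovKernel κ ∧
      (π.map Prod.snd).bind κ = π ∧ νY.bind κ = π' := by
  obtain ⟨K, _, Kfb, _, hπ, -, hπ'⟩ := h
  set P := π.map Prod.snd with hP
  have hone : ∀ᵐ y ∂P, K y Set.univ = 1 := by
    have hm : Measurable fun y => K y Set.univ := K.measurable_coe MeasurableSet.univ
    have hd : P.withDensity (fun y => K y Set.univ) = P.withDensity 1 := by
      rw [withDensity_one]
      ext s hs
      conv_rhs => rw [hP, hπ, mix_eq_bind_prod_id]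
      rw [withDensity_apply _ hs, Measure.map_apply measurable_snd hs,
        Measure.bind_apply (measurable_snd hs) (Kernel.aemeasurable _), ← lintegral_indicator hs]
      refine lintegral_congr fun y => ?_
      rw [Kernel.prod_apply, Kernel.id_apply, ← Set.univ_prod, Measure.prod_prod,
        Measure.dirac_apply' _ hs]
      by_cases hy : y ∈ s <;> simp [hy]
    exact (withDensity_eq_iff_of_sigmaFinite hm.aemeasurable aemeasurable_const).1 hd
  obtain ⟨T, hT, hTs, hTP⟩ := νY.mutuallySingular_singularPart P
  classical
  have hS : MeasurableSet (T ∩ {y | K y Set.univ = 1}) :=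
    hT.inter (K.measurable_coe MeasurableSet.univ (measurableSet_singleton 1))
  have hSP : ∀ᵐ y ∂P, y ∈ T ∩ {y | K y Set.univ = 1} := by
    have hTP' : ∀ᵐ y ∂P, y ∈ T := by rwa [ae_iff]
    filter_upwards [hTP', hone] with y h1 h2 using ⟨h1, h2⟩
  have hSs : ∀ᵐ y ∂(νY.singularPart P), y ∉ T ∩ {y | K y Set.univ = 1} := by
    have hTs' : ∀ᵐ y ∂(νY.singularPart P), y ∉ T := by simpa [ae_iff] using hTs
    filter_upwards [hTs'] with y h1 h2 using h1 h2.1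
  let L : Kernel Y X := Kernel.piecewise hS K Kfb
  have hL : IsMarkovKernel L := by
    refine ⟨fun y => ⟨?_⟩⟩
    rw [Kernel.piecewise_apply]
    split_ifs with hy
    · exact hy.2
    · exact measure_univ
  have hmixK : ∀ η : Measure Y, η ≪ P → η.bind (L ×ₖ Kernel.id) = mix η K := by
    intro η hη
    rw [mix_eq_bind_prod_id]
    refine Measure.bind_congr_right ?_
    filter_upwards [hη.ae_le hSP] with y hy
    rw [Kernel.prod_apply, Kernel.prod_apply, Kernel.piecewise_apply, if_pos hy]
  have hmixfb : (νY.singularPart P).bind (L ×ₖ Kernel.id) = mix (νY.singularPart P) Kfb := by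
    rw [mix_eq_bind_prod_id]
    refine Measure.bind_congr_right ?_
    filter_upwards [hSs] with y hy
    rw [Kernel.prod_apply, Kernel.prod_apply, Kernel.piecewise_apply, if_neg hy]
  refine ⟨L ×ₖ Kernel.id, inferInstance, (hmixK P Measure.AbsolutelyContinuous.rfl).trans hπ.symm,
    ?_⟩
  rw [hπ', ← hmixK _ (withDensity_absolutelyContinuous _ _), ← hmixfb]
  nth_rw 1 [← νY.rnDeriv_add_singularPart P]
  ext s hs
  rw [Measure.add_apply, Measure.bind_apply hs (Kernel.aemeasurable _),
    Measure.bind_apply hs (Kernel.aemeasurable _), Measure.bind_apply hs (Kernel.aemeasurable _),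
    lintegral_add_measure]

/-- A level-optimal maximin plan has opposite marginal absorbing every capped common part. -/
lemma LevelOptMaximin.exists_le_of_le {X Y : Type} [MeasurableSpace X] [MeasurableSpace Y]
    {E : Set (X × Y)} {νX : Measure X} {νY : Measure Y} {π ρ ρ' : Measure (X × Y)}
    (h : LevelOptMaximin E νX νY π) (hρ : ρ ∈ Plans E νX) (hρ' : ρ' ∈ PlansSnd E νY)
    {t : ℝ} (ht : 0 < t) {η : Measure (X × Y)} (hη : η ≤ ρ) (hη' : η ≤ ENNReal.ofReal t • ρ') :
    ∃ τ ≤ π.map Prod.snd, τ ≤ ENNReal.ofReal t • νY ∧ η Set.univ ≤ τ Set.univ := by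
  obtain ⟨hfin, hE, hfst⟩ := hρ
  obtain ⟨-, -, hsnd⟩ := hρ'
  refine ⟨νY.withDensity fun y => min ((π.map Prod.snd).rnDeriv νY y) (ENNReal.ofReal t),
    ?_, ?_, ?_⟩
  · exact (withDensity_mono (ae_of_all _ fun y => min_le_left _ _)).trans
      (Measure.withDensity_rnDeriv_le _ _)
  · rw [← withDensity_const]
    exact withDensity_mono (ae_of_all _ fun y => min_le_right _ _)
  · rw [withDensity_apply _ MeasurableSet.univ, setLIntegral_univ, h t ht]
    refine le_iSup₂_of_le (f := fun (σ : Measure (X × Y)) (_ : σ ∈ Feas E νX νY t) => σ Set.univ)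
      η ⟨isFiniteMeasure_of_le ρ hη, le_antisymm ((hη _).trans_eq hE) zero_le, ?_, ?_⟩ le_rfl
    · rw [← hfst]
      exact Measure.map_mono hη measurable_fst
    · rw [← hsnd, ← Measure.map_smul]
      exact Measure.map_mono hη' measurable_snd

theorem universal_closest_refinement_pair
    [TopologicalSpace X] [PolishSpace X] [BorelSpace X]
    [TopologicalSpace Y] [PolishSpace Y] [BorelSpace Y]
    (E : Set (X × Y)) (hE : IsClosed E)
    (νX : Measure X) (νY : Measure Y) [IsFiniteMeasure νX] [IsFiniteMeasure νY]
    (hνX : 0 < νX Set.univ) (hνY : 0 < νY Set.univ)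
    (hNbhdX : ∀ x : X, ∃ y : Y, (x, y) ∈ E) (hNbhdY : ∀ y : Y, ∃ x : X, (x, y) ∈ E)
    (πι πῑ : Measure (X × Y))
    (hπι : πι ∈ Plans E νX) (hlom : LevelOptMaximin E νX νY πι)
    (hπῑ : πῑ ∈ PlansSnd E νY) (hpr : IsPropResponse E νY πι πῑ) :
    ∀ 𝒟 : Divergence, 𝒟.HasDPI →
      𝒟.D (X × Y) πι πῑ
        = sInf {d : EReal | ∃ ρι ∈ Plans E νX, ∃ ρῑ ∈ PlansSnd E νY,
            d = 𝒟.D (X × Y) ρι ρῑ} := by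
  intro 𝒟 h𝒟
  have := hπι.1
  have := hπῑ.1
  refine le_antisymm (le_sInf ?_) (sInf_le ⟨πι, hπι, πῑ, hπῑ, rfl⟩)
  rintro _ ⟨ρι, hρι, ρῑ, hρῑ, rfl⟩
  have := hρι.1
  have := hρῑ.1
  have : Nonempty Y := by
    by_contra hY
    rw [not_nonempty_iff] at hY
    simp [Measure.eq_zero_of_isEmpty νY] at hνY
  have hmassι : ρι Set.univ = (πι.map Prod.snd) Set.univ := by
    have h₁ := congrArg (fun m => m Set.univ) hρι.2.2
    have h₂ := congrArg (fun m => m Set.univ) hπι.2.2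
    simp only [Measure.map_apply measurable_fst MeasurableSet.univ, Set.preimage_univ] at h₁ h₂
    rw [Measure.map_apply measurable_snd MeasurableSet.univ, Set.preimage_univ, h₁, h₂]
  have hmassῑ : ρῑ Set.univ = νY Set.univ := by
    rw [← hρῑ.2.2, Measure.map_apply measurable_snd MeasurableSet.univ, Set.preimage_univ]
  obtain ⟨K, _, hKι, hKῑ⟩ := exists_kernel_of_common_part_le ρι ρῑ (πι.map Prod.snd) νY
    hmassι hmassῑ (fun t ht η hη hη' => hlom.exists_le_of_le hρι hρῑ ht hη hη')
  obtain ⟨κ, _, hκι, hκῑ⟩ := hpr.exists_kernel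
  calc 𝒟.D (X × Y) πι πῑ ≤ 𝒟.D Y (πι.map Prod.snd) νY := by
        have := h𝒟 Y (X × Y) κ (πι.map Prod.snd) νY
        rwa [hκι, hκῑ] at this
    _ ≤ 𝒟.D (X × Y) ρι ρῑ := by
        have := h𝒟 (X × Y) Y K ρι ρῑ
        rwa [hKι, hKῑ] at this
end
end

section
/- Fix ι ∈ {0,1} and let θ : [0,∞) → ℝ ∪ {+∞} be proper, lower semicontinuous, and strictly convex on its effective domain. Suppose (π_ι, π_ῑ) ∈ Π_ι × Π_ῑ satisfies D_θ(π_ι‖π_ῑ) = inf{D_θ(ρ_ι‖ρ_ῑ) : (ρ_ι, ρ_ῑ) ∈ Π_ι × Π_ῑ} < ∞, where D_θ is evaluated between finite measures on Ω0 × Ω1. Then (i) π_ι is level-optimal maximin, and (ii) π_ῑ is a proportional response to π_ι. -/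
/- STATEMENT 14: Strictly convex closest pairs have the level-optimal-maximin /
proportional-response structure (Theorem `strict_convex_closest_pair_induces_canonical_pair`).
The side `ι ∈ {0,1}` is formalized abstractly: `X` plays the role of `Ω_ι` and `Y` of `Ω_ῑ`. -/

open MeasureTheory ProbabilityTheory Filter
open scoped ENNReal NNReal

noncomputable section

/-- The nonnegative part of an extended real number, as an element of `ℝ≥0∞`. -/
def erealToENNReal (a : EReal) : ℝ≥0∞ :=
  if a = ⊤ then ⊤ else ENNReal.ofReal a.toReal

/-- Extended-real integral via positive/negative parts. -/
def erealIntegral {Ω : Type} [MeasurableSpace Ω] (μ : Measure Ω) (f : Ω → EReal) : EReal :=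
  ((∫⁻ x, erealToENNReal (f x) ∂μ : ℝ≥0∞) : EReal)
    - ((∫⁻ x, erealToENNReal (-f x) ∂μ : ℝ≥0∞) : EReal)

/-- Recession slope of `θ`, i.e. `lim_{t → ∞} θ t / t`. -/
def recessionSlope (θ : ℝ → EReal) : EReal :=
  Filter.limsup (fun t : ℝ => θ t * ((t⁻¹ : ℝ) : EReal)) Filter.atTop

/-- The `θ`-divergence `D_θ(P‖Q) = ∫ θ(dP_ac/dQ) dQ + θ'_∞ · P⊥(Ω)`. -/
def thetaDiv {Ω : Type} [MeasurableSpace Ω] (θ : ℝ → EReal) (P Q : Measure Ω) : EReal :=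
  erealIntegral Q (fun x => θ ((P.rnDeriv Q x).toReal))
    + recessionSlope θ * ((P.singularPart Q Set.univ : ℝ≥0∞) : EReal)

/-- `θ : [0,∞) → ℝ ∪ {+∞}` is proper, convex and lower semicontinuous. -/
structure ProperConvexLSCOn (θ : ℝ → EReal) : Prop where
  ne_bot : ∀ x : ℝ, 0 ≤ x → θ x ≠ ⊥
  exists_ne_top : ∃ x : ℝ, 0 ≤ x ∧ θ x ≠ ⊤
  convex : ∀ x y a b : ℝ, 0 ≤ x → 0 ≤ y → 0 ≤ a → 0 ≤ b → a + b = 1 →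
    θ (a * x + b * y) ≤ (a : EReal) * θ x + (b : EReal) * θ y
  lsc : LowerSemicontinuousOn θ (Set.Ici 0)

/-- `θ` is strictly convex on its effective domain (within `[0,∞)`). -/
def StrictlyConvexOnDom (θ : ℝ → EReal) : Prop :=
  ∀ x y a b : ℝ, 0 ≤ x → 0 ≤ y → x ≠ y → θ x ≠ ⊤ → θ y ≠ ⊤ → 0 < a → 0 < b → a + b = 1 →
    θ (a * x + b * y) < (a : EReal) * θ x + (b : EReal) * θ y

variable {X Y : Type} [MeasurableSpace X] [MeasurableSpace Y]

section ConvexAnalysis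

/-- A strictly convex function has a strict supporting line at interior points. -/
theorem StrictConvexOn.exists_strict_support {J : Set ℝ} {g : ℝ → ℝ} (hg : StrictConvexOn ℝ J g)
    {a c b : ℝ} (ha : a ∈ J) (hb : b ∈ J) (hac : a < c) (hcb : c < b) :
    ∃ k : ℝ, ∀ x ∈ J, x ≠ c → g c + k * (x - c) < g x := by
  have hord := hg.1.ordConnected
  have hc : c ∈ J := hord.out ha hb ⟨hac.le, hcb.le⟩
  set S : ℝ → ℝ := fun x => (g x - g c) / (x - c) with hS
  have hmono : ∀ x ∈ J, ∀ y ∈ J, x ≠ c → y ≠ c → x < y → S x < S y := fun x hx y hy hxc hyc hxy =>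
    hg.secant_strict_mono hc hx hy hxc hyc hxy
  set T : Set ℝ := S '' {x | x ∈ J ∧ x < c} with hT
  have hTne : T.Nonempty := ⟨S a, a, ⟨ha, hac⟩, rfl⟩
  have hub : ∀ y ∈ J, c < y → S y ∈ upperBounds T := by
    rintro y hy hcy _ ⟨x, ⟨hx, hxc⟩, rfl⟩
    exact (hmono x hx y hy hxc.ne hcy.ne' (hxc.trans hcy)).le
  have hbdd : BddAbove T := ⟨S b, hub b hb hcb⟩
  refine ⟨sSup T, fun x hx hxc => ?_⟩
  have hmid : (x + c) / 2 ∈ J := by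
    rcases lt_or_gt_of_ne hxc with h | h
    · exact hord.out hx hc ⟨by linarith, by linarith⟩
    · exact hord.out hc hx ⟨by linarith, by linarith⟩
  have hgx : g x = g c + S x * (x - c) := by
    simp only [hS]
    rw [div_mul_cancel₀ _ (sub_ne_zero.2 hxc)]; ring
  rcases lt_or_gt_of_ne hxc with h | h
  · have h1 : S x < S ((x + c) / 2) :=
      hmono _ hx _ hmid hxc (by intro h'; linarith) (by linarith)
    have h2 : S ((x + c) / 2) ≤ sSup T := le_csSup hbdd ⟨_, ⟨hmid, by linarith⟩, rfl⟩
    rw [hgx]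
    nlinarith
  · have h1 : S ((x + c) / 2) < S x :=
      hmono _ hmid _ hx (by intro h'; linarith) hxc (by linarith)
    have h2 : sSup T ≤ S ((x + c) / 2) := csSup_le hTne (hub _ hmid (by linarith))
    rw [hgx]
    nlinarith

/-- Strict convexity on the effective domain for `ℝ≥0∞`-valued functions on a set `D`. -/
def ENNStrictConvexOn (D : Set ℝ) (φ : ℝ → ℝ≥0∞) : Prop :=
  ∀ x ∈ D, ∀ y ∈ D, x < y → φ x ≠ ⊤ → φ y ≠ ⊤ → ∀ a b : ℝ, 0 < a → 0 < b → a + b = 1 →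
    φ (a * x + b * y) < ENNReal.ofReal a * φ x + ENNReal.ofReal b * φ y

theorem ENNStrictConvexOn.strictConvexOn_toReal {D : Set ℝ} {φ : ℝ → ℝ≥0∞} (hD : Convex ℝ D)
    (h : ENNStrictConvexOn D φ) :
    StrictConvexOn ℝ {x | x ∈ D ∧ φ x ≠ ⊤} (fun x => (φ x).toReal) := by
  have hfin : ∀ x y a b : ℝ, φ x ≠ ⊤ → φ y ≠ ⊤ →
      ENNReal.ofReal a * φ x + ENNReal.ofReal b * φ y ≠ ⊤ := fun x y a b hx hy =>
    ENNReal.add_ne_top.2 ⟨ENNReal.mul_ne_top ENNReal.ofReal_ne_top hx,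
      ENNReal.mul_ne_top ENNReal.ofReal_ne_top hy⟩
  refine LinearOrder.strictConvexOn_of_lt ?_ ?_
  · rw [convex_iff_pairwise_pos]
    rintro x ⟨hx, hx'⟩ y ⟨hy, hy'⟩ hxy a b ha hb hab
    refine ⟨hD hx hy ha.le hb.le hab, ?_⟩
    rcases lt_or_gt_of_ne hxy with hlt | hlt
    · exact ((h x hx y hy hlt hx' hy' a b ha hb hab).trans_le le_top).ne
    · rw [add_comm]
      exact ((h y hy x hx hlt hy' hx' b a hb ha (by linarith)).trans_le le_top).ne
  · rintro x ⟨hx, hx'⟩ y ⟨hy, hy'⟩ hxy a b ha hb hab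
    have := (ENNReal.toReal_lt_toReal (((h x hx y hy hxy hx' hy' a b ha hb hab).trans_le
      le_top).ne) (hfin x y a b hx' hy')).2 (h x hx y hy hxy hx' hy' a b ha hb hab)
    rw [ENNReal.toReal_add (ENNReal.mul_ne_top ENNReal.ofReal_ne_top hx')
      (ENNReal.mul_ne_top ENNReal.ofReal_ne_top hy'), ENNReal.toReal_mul, ENNReal.toReal_mul,
      ENNReal.toReal_ofReal ha.le, ENNReal.toReal_ofReal hb.le] at this
    exact this

/-- A nonnegative strictly convex integrand on `[0,∞)` together with its recession value. -/
structure StrictConvexProfile (f : ℝ → ℝ≥0∞) (s : ℝ≥0∞) : Prop where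
  measurable : Measurable f
  strict : ENNStrictConvexOn (Set.Ici 0) f
  recession : ∀ x h : ℝ, 0 ≤ x → 0 < h → f x ≠ ⊤ → s ≠ ⊤ → f (x + h) < f x + ENNReal.ofReal h * s

/-- The perspective of the integrand `f`, restricted to the segment `p + q = 1`. -/
def segmentPerspective (f : ℝ → ℝ≥0∞) (s : ℝ≥0∞) (p : ℝ) : ℝ≥0∞ :=
  if p = 1 then s else ENNReal.ofReal (1 - p) * f (p / (1 - p))

theorem measurable_segmentPerspective {f : ℝ → ℝ≥0∞} (s : ℝ≥0∞) (hf : Measurable f) :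
    Measurable (segmentPerspective f s) := by
  unfold segmentPerspective
  refine Measurable.ite (measurableSet_singleton 1) measurable_const ?_
  refine Measurable.mul (by fun_prop) (hf.comp (by fun_prop))

theorem StrictConvexProfile.segmentPerspective_strict {f : ℝ → ℝ≥0∞} {s : ℝ≥0∞}
    (h : StrictConvexProfile f s) :
    ENNStrictConvexOn (Set.Icc 0 1) (segmentPerspective f s) := by
  rintro x ⟨hx0, hx1⟩ y ⟨hy0, hy1⟩ hxy hfx hfy a b ha hb hab
  have hx1' : x < 1 := hxy.trans_le hy1
  have key : ∀ z < (1 : ℝ), segmentPerspective f s z ≠ ⊤ → f (z / (1 - z)) ≠ ⊤ := by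
    intro z hz hfz hcon
    apply hfz
    rw [segmentPerspective, if_neg hz.ne, hcon, ENNReal.mul_top]
    simpa using hz
  have hfx' := key x hx1' hfx
  have hz1 : a * x + b * y < 1 := by nlinarith
  have h1x : 0 < 1 - x := by linarith
  have h1z : 0 < 1 - (a * x + b * y) := by linarith
  rw [segmentPerspective, if_neg hz1.ne, segmentPerspective, if_neg hx1'.ne]
  rcases hy1.lt_or_eq with hy1' | rfl
  · have h1y : 0 < 1 - y := by linarith
    have hfy' := key y hy1' hfy
    rw [segmentPerspective, if_neg hy1'.ne]
    set w := 1 - (a * x + b * y) with hw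
    have hcomb : a * (1 - x) / w + b * (1 - y) / w = 1 := by
      rw [← add_div, div_eq_one_iff_eq h1z.ne', hw]; linear_combination hab
    have hpt : (a * x + b * y) / w = a * (1 - x) / w * (x / (1 - x)) +
        b * (1 - y) / w * (y / (1 - y)) := by
      field_simp
    have := h.strict (x / (1 - x)) (div_nonneg hx0 h1x.le) (y / (1 - y)) (div_nonneg hy0 h1y.le)
      (by rw [div_lt_div_iff₀ h1x h1y]; nlinarith) hfx' hfy' _ _ (by positivity) (by positivity)
      hcomb
    rw [← hpt] at this
    calc _ < ENNReal.ofReal w * (ENNReal.ofReal (a * (1 - x) / w) * f (x / (1 - x)) +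
        ENNReal.ofReal (b * (1 - y) / w) * f (y / (1 - y))) :=
          (ENNReal.mul_lt_mul_iff_right (by simpa using h1z) ENNReal.ofReal_ne_top).2 this
      _ = _ := by
        rw [mul_add, ← mul_assoc, ← mul_assoc, ← mul_assoc, ← mul_assoc,
          ← ENNReal.ofReal_mul h1z.le,
          ← ENNReal.ofReal_mul h1z.le, ← ENNReal.ofReal_mul ha.le, ← ENNReal.ofReal_mul hb.le,
          mul_div_cancel₀ _ h1z.ne', mul_div_cancel₀ _ h1z.ne']
  · have hs : s ≠ ⊤ := by simpa [segmentPerspective] using hfy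
    rw [segmentPerspective, if_pos rfl]
    have hw : 1 - (a * x + b * 1) = a * (1 - x) := by linear_combination -hab
    have hpt : (a * x + b * 1) / (1 - (a * x + b * 1)) = x / (1 - x) + b / (a * (1 - x)) := by
      rw [hw]; field_simp
    have := h.recession (x / (1 - x)) (b / (a * (1 - x))) (div_nonneg hx0 h1x.le) (by positivity)
      hfx' hs
    rw [hpt, hw]
    calc _ < ENNReal.ofReal (a * (1 - x)) * (f (x / (1 - x)) +
          ENNReal.ofReal (b / (a * (1 - x))) * s) :=
          (ENNReal.mul_lt_mul_iff_right (by simp; positivity) ENNReal.ofReal_ne_top).2 this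
      _ = _ := by
        rw [mul_add, ← mul_assoc, ← mul_assoc, ← ENNReal.ofReal_mul (by positivity),
          ← ENNReal.ofReal_mul ha.le, mul_div_cancel₀ _ (by positivity)]

end ConvexAnalysis

section Normalization

theorem ProperConvexLSCOn.measurable_comp_max {θ : ℝ → EReal} (hθ : ProperConvexLSCOn θ) :
    Measurable (fun x : ℝ => θ (max x 0)) := by
  have : LowerSemicontinuous (fun x : ℝ => θ (max x 0)) := by
    rw [← lowerSemicontinuousOn_univ_iff]
    exact hθ.lsc.comp (by fun_prop) (fun x _ => le_max_right x 0)
  exact this.measurable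

theorem ProperConvexLSCOn.coe_toReal {θ : ℝ → EReal} (hθ : ProperConvexLSCOn θ) {x : ℝ}
    (hx : 0 ≤ x) (hx' : θ x ≠ ⊤) : ((θ x).toReal : EReal) = θ x :=
  EReal.coe_toReal hx' (hθ.ne_bot x hx)

theorem StrictlyConvexOnDom.strictConvexOn_toReal {θ : ℝ → EReal} (hθ : ProperConvexLSCOn θ)
    (hs : StrictlyConvexOnDom θ) :
    StrictConvexOn ℝ {x | 0 ≤ x ∧ θ x ≠ ⊤} (fun x => (θ x).toReal) := by
  have main : ∀ x y a b : ℝ, 0 ≤ x → θ x ≠ ⊤ → 0 ≤ y → θ y ≠ ⊤ → x ≠ y → 0 < a → 0 < b →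
      a + b = 1 → θ (a * x + b * y) ≠ ⊤ ∧
        (θ (a * x + b * y)).toReal < a * (θ x).toReal + b * (θ y).toReal := by
    intro x y a b hx hx' hy hy' hxy ha hb hab
    have h := hs x y a b hx hy hxy hx' hy' ha hb hab
    have hnn : 0 ≤ a * x + b * y := by positivity
    have h' : θ (a * x + b * y) ≠ ⊤ := (h.trans_le le_top).ne
    refine ⟨h', ?_⟩
    rw [← hθ.coe_toReal hx hx', ← hθ.coe_toReal hy hy', ← hθ.coe_toReal hnn h'] at h
    exact_mod_cast h
  refine ⟨?_, ?_⟩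
  · rw [convex_iff_pairwise_pos]
    rintro x ⟨hx, hx'⟩ y ⟨hy, hy'⟩ hxy a b ha hb hab
    simp only [smul_eq_mul]
    exact ⟨by positivity, (main x y a b hx hx' hy hy' hxy ha hb hab).1⟩
  · rintro x ⟨hx, hx'⟩ y ⟨hy, hy'⟩ hxy a b ha hb hab
    exact (main x y a b hx hx' hy hy' hxy ha hb hab).2

theorem le_recessionSlope {θ : ℝ → EReal} {m c : ℝ}
    (h : ∀ᶠ t in atTop, ((m * t + c : ℝ) : EReal) ≤ θ t) : (m : EReal) ≤ recessionSlope θ := by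
  have hlim : Tendsto (fun t : ℝ => ((m + c * t⁻¹ : ℝ) : EReal)) atTop (nhds (m : EReal)) := by
    refine (continuous_coe_real_ereal.tendsto m).comp ?_
    have := (tendsto_inv_atTop_zero (𝕜 := ℝ)).const_mul c
    simpa using this.const_add m
  rw [← hlim.limsup_eq]
  refine limsup_le_limsup ?_
  filter_upwards [h, eventually_gt_atTop 0] with t ht htpos
  have h1 : ((m + c * t⁻¹ : ℝ) : EReal) = ((m * t + c : ℝ) : EReal) * ((t⁻¹ : ℝ) : EReal) := by
    rw [← EReal.coe_mul]
    congr 1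
    field_simp
  rw [h1]
  exact mul_le_mul_of_nonneg_right ht (by exact_mod_cast (inv_pos.2 htpos).le)

theorem StrictlyConvexOnDom.ne_top_of_recessionSlope_ne_top {θ : ℝ → EReal}
    (hθ : ProperConvexLSCOn θ) (hs : StrictlyConvexOnDom θ) (hR : recessionSlope θ ≠ ⊤)
    {x : ℝ} (hx : 0 ≤ x) (hx' : θ x ≠ ⊤) {t : ℝ} (ht : x ≤ t) : θ t ≠ ⊤ := by
  intro hcon
  apply hR
  rw [EReal.eq_top_iff_forall_lt]
  intro m
  refine lt_of_lt_of_le (b := ((m + 1 : ℝ) : EReal)) (by exact_mod_cast lt_add_one m) ?_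
  refine le_recessionSlope (c := 0) ?_
  filter_upwards [eventually_ge_atTop t] with u hu
  have hu' : θ u = ⊤ := by
    by_contra hne
    exact ((hs.strictConvexOn_toReal hθ).1.ordConnected.out ⟨hx, hx'⟩
      ⟨hx.trans (ht.trans hu), hne⟩ ⟨ht, hu⟩).2 hcon
  rw [hu']
  exact le_top

theorem StrictlyConvexOnDom.lt_add_recessionSlope {θ : ℝ → EReal}
    (hθ : ProperConvexLSCOn θ) (hs : StrictlyConvexOnDom θ)
    {R : ℝ} (hR : recessionSlope θ = R) {x h : ℝ} (hx : 0 ≤ x) (hx' : θ x ≠ ⊤) (hh : 0 < h) :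
    (θ (x + h)).toReal < (θ x).toReal + h * R := by
  have hg := hs.strictConvexOn_toReal hθ
  have hR' : recessionSlope θ ≠ ⊤ := by rw [hR]; exact EReal.coe_ne_top R
  have hmem : ∀ t, x ≤ t → t ∈ {x | 0 ≤ x ∧ θ x ≠ ⊤} := fun t ht =>
    ⟨hx.trans ht, hs.ne_top_of_recessionSlope_ne_top hθ hR' hx hx' ht⟩
  set g : ℝ → ℝ := fun t => (θ t).toReal with hgdef
  have h1 := hg.slope_strict_mono_adjacent (hmem x le_rfl) (hmem (x + 2 * h) (by linarith))
    (y := x + h) (by linarith) (by linarith)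
  set m := (g (x + 2 * h) - g (x + h)) / (x + 2 * h - (x + h)) with hm
  have hmR : m ≤ R := by
    rw [← EReal.coe_le_coe_iff, ← hR]
    refine le_recessionSlope (c := g (x + h) - m * (x + h)) ?_
    filter_upwards [eventually_gt_atTop (x + 2 * h)] with t ht
    have h2 := hg.secant_strict_mono (hmem (x + h) (by linarith)) (hmem (x + 2 * h) (by linarith))
      (hmem t (by linarith)) (by linarith) (by linarith) ht
    rw [← hm, lt_div_iff₀ (by linarith)] at h2
    rw [← hθ.coe_toReal (hmem t (by linarith)).1 (hmem t (by linarith)).2]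
    have : m * t + (g (x + h) - m * (x + h)) ≤ g t := by linarith
    exact_mod_cast this
  rw [div_lt_iff₀ (by linarith)] at h1
  have : m * (x + h - x) ≤ R * h := by nlinarith
  change g (x + h) < g x + h * R
  linarith

/-- Subtracting an affine minorant turns `θ` into a nonnegative strictly convex integrand. -/
theorem StrictlyConvexOnDom.exists_profile {θ : ℝ → EReal}
    (hθ : ProperConvexLSCOn θ) (hs : StrictlyConvexOnDom θ) {α β : ℝ}
    (hmin : ∀ x, 0 ≤ x → ((α * x + β : ℝ) : EReal) ≤ θ x) :
    ∃ (f : ℝ → ℝ≥0∞) (s : ℝ≥0∞), StrictConvexProfile f s ∧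
      (∀ x, 0 ≤ x → θ x = (f x : EReal) + ((α * x + β : ℝ) : EReal)) ∧
      recessionSlope θ = (s : EReal) + (α : EReal) := by
  set l : ℝ → ℝ := fun x => α * max x 0 + β with hl
  set f : ℝ → ℝ≥0∞ := fun x => (θ (max x 0) - (l x : EReal)).toENNReal with hf
  set s : ℝ≥0∞ := (recessionSlope θ - (α : EReal)).toENNReal with hsdef
  have hαR : (α : EReal) ≤ recessionSlope θ :=
    le_recessionSlope (c := β) ((eventually_ge_atTop 0).mono hmin)
  have hsR : recessionSlope θ = (s : EReal) + (α : EReal) := by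
    rw [hsdef, EReal.coe_toENNReal (EReal.sub_nonneg (by simp) (by simp) |>.2 hαR)]
    exact (EReal.sub_add_cancel (a := recessionSlope θ) (b := α)).symm
  have hfθ : ∀ x, 0 ≤ x → θ x = (f x : EReal) + ((α * x + β : ℝ) : EReal) := by
    intro x hx
    have h0 := hmin x hx
    simp only [hf, hl, max_eq_left hx]
    rw [EReal.coe_toENNReal (EReal.sub_nonneg (.inr (EReal.coe_ne_top _))
      (.inr (EReal.coe_ne_bot _)) |>.2 h0)]
    exact (EReal.sub_add_cancel (a := θ x) (b := (α * x + β : ℝ))).symm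
  have htop : ∀ x, 0 ≤ x → (f x ≠ ⊤ ↔ θ x ≠ ⊤) := by
    intro x hx
    rw [hfθ x hx, not_iff_not]
    constructor
    · intro h; rw [h]; exact EReal.top_add_coe _
    · intro h
      by_contra hne
      lift f x to ℝ≥0 using hne with r
      have : ((r : ℝ≥0∞) : EReal) = ((r : ℝ) : EReal) := rfl
      rw [this, ← EReal.coe_add] at h
      exact EReal.coe_ne_top _ h
  have hval : ∀ x, 0 ≤ x → θ x ≠ ⊤ → 0 ≤ (θ x).toReal - (α * x + β) ∧
      f x = ENNReal.ofReal ((θ x).toReal - (α * x + β)) := by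
    intro x hx hx'
    have h0 := hmin x hx
    rw [← hθ.coe_toReal hx hx', EReal.coe_le_coe_iff] at h0
    refine ⟨by linarith, ?_⟩
    simp only [hf, hl, max_eq_left hx]
    rw [← hθ.coe_toReal hx hx', ← EReal.coe_sub, EReal.real_coe_toENNReal, EReal.toReal_coe]
  refine ⟨f, s, ⟨?_, ?_, ?_⟩, hfθ, hsR⟩
  · refine measurable_ereal_toENNReal.comp ?_
    have h1 : Measurable fun x : ℝ => ((-l x : ℝ) : EReal) :=
      measurable_coe_real_ereal.comp (by fun_prop)
    have := hθ.measurable_comp_max.add h1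
    simp only [sub_eq_add_neg]
    exact this
  · intro x hx y hy hxy hfx hfy a b ha hb hab
    have hx0 : (0 : ℝ) ≤ x := hx
    have hy0 : (0 : ℝ) ≤ y := hy
    have hz0 : 0 ≤ a * x + b * y := by positivity
    have hx' := (htop x hx0).1 hfx
    have hy' := (htop y hy0).1 hfy
    have hg := hs.strictConvexOn_toReal hθ
    have hz' : θ (a * x + b * y) ≠ ⊤ :=
      (hg.1 ⟨hx0, hx'⟩ ⟨hy0, hy'⟩ ha.le hb.le hab).2
    have hlt := hg.2 ⟨hx0, hx'⟩ ⟨hy0, hy'⟩ hxy.ne ha hb hab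
    simp only [smul_eq_mul] at hlt
    obtain ⟨hxn, hxe⟩ := hval x hx0 hx'
    obtain ⟨hyn, hye⟩ := hval y hy0 hy'
    obtain ⟨hzn, hze⟩ := hval _ hz0 hz'
    rw [hxe, hye, hze, ← ENNReal.ofReal_mul ha.le, ← ENNReal.ofReal_mul hb.le,
      ← ENNReal.ofReal_add (by positivity) (by positivity),
      ENNReal.ofReal_lt_ofReal_iff_of_nonneg hzn]
    have : β = a * β + b * β := by rw [← add_mul, hab, one_mul]
    nlinarith
  · intro x h hx hh hfx hst
    have hx' := (htop x hx).1 hfx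
    have hR : recessionSlope θ = ((s.toReal + α : ℝ) : EReal) := by
      rw [hsR, EReal.coe_add]
      conv_lhs => rw [← ENNReal.ofReal_toReal hst]
      rw [EReal.coe_ennreal_ofReal, max_eq_left ENNReal.toReal_nonneg]
    have hz' : θ (x + h) ≠ ⊤ := hs.ne_top_of_recessionSlope_ne_top hθ
      (by rw [hR]; exact EReal.coe_ne_top _) hx hx' (by linarith)
    have hlt := hs.lt_add_recessionSlope hθ hR hx hx' hh
    obtain ⟨hxn, hxe⟩ := hval x hx hx'
    obtain ⟨hzn, hze⟩ := hval _ (by positivity) hz'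
    rw [hxe, hze, ← ENNReal.ofReal_toReal hst, ← ENNReal.ofReal_mul hh.le,
      ← ENNReal.ofReal_add hxn (by positivity),
      ENNReal.ofReal_lt_ofReal_iff_of_nonneg hzn]
    nlinarith

theorem StrictlyConvexOnDom.exists_touching_minorant {θ : ℝ → EReal}
    (hθ : ProperConvexLSCOn θ) (hs : StrictlyConvexOnDom θ) {a c b : ℝ}
    (ha : 0 ≤ a) (ha' : θ a ≠ ⊤) (hb : θ b ≠ ⊤) (hac : a < c) (hcb : c < b) :
    ∃ α β : ℝ, θ c = ((α * c + β : ℝ) : EReal) ∧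
      ∀ x, 0 ≤ x → ((α * x + β : ℝ) : EReal) ≤ θ x ∧
        (x ≠ c → ((α * x + β : ℝ) : EReal) < θ x) := by
  have hg := hs.strictConvexOn_toReal hθ
  have hbm : b ∈ {x | 0 ≤ x ∧ θ x ≠ ⊤} := ⟨by linarith, hb⟩
  have ham : a ∈ {x | 0 ≤ x ∧ θ x ≠ ⊤} := ⟨ha, ha'⟩
  obtain ⟨k, hk⟩ := hg.exists_strict_support ham hbm hac hcb
  have hc := hg.1.ordConnected.out ham hbm ⟨hac.le, hcb.le⟩
  have hceq : θ c = ((k * c + ((θ c).toReal - k * c) : ℝ) : EReal) := by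
    rw [add_sub_cancel, hθ.coe_toReal hc.1 hc.2]
  refine ⟨k, (θ c).toReal - k * c, hceq, fun x hx => ?_⟩
  have hlt : x ≠ c → ((k * x + ((θ c).toReal - k * c) : ℝ) : EReal) < θ x := by
    intro hxc
    by_cases hx' : θ x = ⊤
    · rw [hx']; exact EReal.coe_lt_top _
    · rw [← hθ.coe_toReal hx hx', EReal.coe_lt_coe_iff]
      have := hk x ⟨hx, hx'⟩ hxc
      linarith
  refine ⟨?_, hlt⟩
  rcases eq_or_ne x c with rfl | hxc
  · exact hceq.ge
  · exact (hlt hxc).le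

theorem StrictlyConvexOnDom.exists_minorant {θ : ℝ → EReal}
    (hθ : ProperConvexLSCOn θ) (hs : StrictlyConvexOnDom θ) :
    ∃ α β : ℝ, ∀ x, 0 ≤ x → ((α * x + β : ℝ) : EReal) ≤ θ x := by
  obtain ⟨a, ha, ha'⟩ := hθ.exists_ne_top
  by_cases h : ∃ b, 0 ≤ b ∧ θ b ≠ ⊤ ∧ b ≠ a
  · obtain ⟨b, hb, hb', hba⟩ := h
    rcases lt_or_gt_of_ne hba with hlt | hlt
    · obtain ⟨α, β, -, h⟩ := hs.exists_touching_minorant hθ (c := (a + b) / 2) hb hb' ha'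
        (by linarith) (by linarith)
      exact ⟨α, β, fun x hx => (h x hx).1⟩
    · obtain ⟨α, β, -, h⟩ := hs.exists_touching_minorant hθ (c := (a + b) / 2) ha ha' hb'
        (by linarith) (by linarith)
      exact ⟨α, β, fun x hx => (h x hx).1⟩
  · push Not at h
    refine ⟨0, (θ a).toReal, fun x hx => ?_⟩
    rw [zero_mul, zero_add, hθ.coe_toReal ha ha']
    by_cases hx' : θ x = ⊤
    · rw [hx']; exact le_top
    · rw [h x hx hx']

end Normalization

section Divergence

/-- The divergence of a nonnegative integrand `f` with recession value `s`. -/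
def profileDiv {Ω : Type} [MeasurableSpace Ω] (f : ℝ → ℝ≥0∞) (s : ℝ≥0∞) (P Q : Measure Ω) : ℝ≥0∞ :=
  ∫⁻ x, f ((P.rnDeriv Q x).toReal) ∂Q + s * P.singularPart Q Set.univ

theorem erealToENNReal_top : erealToENNReal ⊤ = ⊤ := if_pos rfl

theorem erealToENNReal_coe (r : ℝ) : erealToENNReal (r : EReal) = ENNReal.ofReal r := by
  rw [erealToENNReal, if_neg (EReal.coe_ne_top r), EReal.toReal_coe]

theorem ofReal_add_affine_identity (a : ℝ≥0∞) (l : ℝ) :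
    erealToENNReal ((a : EReal) + (l : EReal)) + ENNReal.ofReal (-l) =
      a + ENNReal.ofReal l + erealToENNReal (-((a : EReal) + (l : EReal))) := by
  rcases eq_or_ne a ⊤ with rfl | ha
  · rw [EReal.coe_ennreal_top, EReal.top_add_coe, erealToENNReal_top]
    simp
  · have h : (a : EReal) + (l : EReal) = ((a.toReal + l : ℝ) : EReal) := by
      conv_lhs => rw [← ENNReal.ofReal_toReal ha]
      rw [EReal.coe_ennreal_ofReal, max_eq_left ENNReal.toReal_nonneg, EReal.coe_add]
    have h0 : 0 ≤ a.toReal := ENNReal.toReal_nonneg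
    rw [h, ← EReal.coe_neg, erealToENNReal_coe, erealToENNReal_coe]
    conv_rhs => rw [← ENNReal.ofReal_toReal ha, ENNReal.toReal_ofReal h0]
    rcases le_total 0 l with hl | hl
    · rw [ENNReal.ofReal_of_nonpos (by linarith : -l ≤ 0),
        ENNReal.ofReal_of_nonpos (by linarith : -(a.toReal + l) ≤ 0),
        ENNReal.ofReal_add h0 hl]
    · rw [ENNReal.ofReal_of_nonpos hl]
      rcases le_total 0 (a.toReal + l) with h1 | h1
      · rw [ENNReal.ofReal_of_nonpos (by linarith : -(a.toReal + l) ≤ 0),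
          ← ENNReal.ofReal_add h1 (by linarith)]
        simp
      · rw [ENNReal.ofReal_of_nonpos h1, add_zero, ← ENNReal.ofReal_add h0 (by linarith)]
        simp

theorem EReal.coe_ennreal_sub_eq_of_add_eq {A B F p n : ℝ≥0∞} (hB : B ≠ ⊤) (hp : p ≠ ⊤) (hn : n ≠ ⊤)
    (h : A + n = F + p + B) :
    (A : EReal) - (B : EReal) = (F : EReal) + ((p.toReal - n.toReal : ℝ) : EReal) := by
  have hcoe : ∀ x : ℝ≥0∞, x ≠ ⊤ → (x : EReal) = ((x.toReal : ℝ) : EReal) := by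
    intro x hx
    conv_lhs => rw [← ENNReal.ofReal_toReal hx]
    rw [EReal.coe_ennreal_ofReal, max_eq_left ENNReal.toReal_nonneg]
  rcases eq_or_ne F ⊤ with rfl | hF
  · have hA : A = ⊤ := by
      by_contra hA
      have : A + n ≠ ⊤ := ENNReal.add_ne_top.2 ⟨hA, hn⟩
      exact this (by rw [h]; simp)
    rw [hA, hcoe B hB, EReal.coe_ennreal_top, EReal.top_sub_coe, EReal.top_add_coe]
  · have hA : A ≠ ⊤ := fun hA => by
      have : F + p + B ≠ ⊤ := ENNReal.add_ne_top.2 ⟨ENNReal.add_ne_top.2 ⟨hF, hp⟩, hB⟩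
      exact this (by rw [← h, hA]; simp)
    have h' := congrArg ENNReal.toReal h
    rw [ENNReal.toReal_add hA hn, ENNReal.toReal_add (ENNReal.add_ne_top.2 ⟨hF, hp⟩) hB,
      ENNReal.toReal_add hF hp] at h'
    rw [hcoe A hA, hcoe B hB, hcoe F hF, ← EReal.coe_sub, ← EReal.coe_add]
    congr 1
    linarith

theorem thetaDiv_eq_profileDiv_add {Ω : Type} [MeasurableSpace Ω] {θ : ℝ → EReal}
    {f : ℝ → ℝ≥0∞} {s : ℝ≥0∞} {α β : ℝ} (hf : Measurable f)
    (hfθ : ∀ x, 0 ≤ x → θ x = (f x : EReal) + ((α * x + β : ℝ) : EReal))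
    (hsR : recessionSlope θ = (s : EReal) + (α : EReal))
    (P Q : Measure Ω) [IsFiniteMeasure P] [IsFiniteMeasure Q] :
    thetaDiv θ P Q = (profileDiv f s P Q : EReal) +
      ((α * P.real Set.univ + β * Q.real Set.univ : ℝ) : EReal) := by
  set u : Ω → ℝ := fun x => (P.rnDeriv Q x).toReal with hu
  have hui : Integrable u Q := Measure.integrable_toReal_rnDeriv
  set l : Ω → ℝ := fun x => α * u x + β with hl
  have hli : Integrable l Q := (hui.const_mul α).add (integrable_const β)
  set Sg : ℝ≥0∞ := P.singularPart Q Set.univ with hSg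
  have hSfin : Sg ≠ ⊤ := measure_ne_top _ _
  have hp : ∫⁻ x, ENNReal.ofReal (l x) ∂Q ≠ ⊤ := hli.lintegral_lt_top.ne
  have hn : ∫⁻ x, ENNReal.ofReal (-l x) ∂Q ≠ ⊤ := hli.neg.lintegral_lt_top.ne
  have hθu : ∀ x, θ (u x) = (f (u x) : EReal) + (l x : EReal) :=
    fun x => hfθ (u x) ENNReal.toReal_nonneg
  have hB : ∫⁻ x, erealToENNReal (-θ (u x)) ∂Q ≠ ⊤ := by
    refine ne_top_of_le_ne_top hn (lintegral_mono fun x => ?_)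
    rw [hθu x]
    rcases eq_or_ne (f (u x)) ⊤ with h | h
    · rw [h, EReal.coe_ennreal_top, EReal.top_add_coe, EReal.neg_top, erealToENNReal]
      simp
    · conv_lhs => rw [← ENNReal.ofReal_toReal h]
      rw [EReal.coe_ennreal_ofReal, max_eq_left ENNReal.toReal_nonneg, ← EReal.coe_add,
        ← EReal.coe_neg, erealToENNReal_coe]
      refine ENNReal.ofReal_le_ofReal ?_
      have : 0 ≤ (f (u x)).toReal := ENNReal.toReal_nonneg
      linarith
  have hadd : ∫⁻ x, erealToENNReal (θ (u x)) ∂Q + ∫⁻ x, ENNReal.ofReal (-l x) ∂Q =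
      ∫⁻ x, f (u x) ∂Q + ∫⁻ x, ENNReal.ofReal (l x) ∂Q + ∫⁻ x, erealToENNReal (-θ (u x)) ∂Q := by
    rw [← lintegral_add_right _ (by fun_prop), ← lintegral_add_right _ (by fun_prop),
      ← lintegral_add_left (by fun_prop)]
    refine lintegral_congr fun x => ?_
    rw [hθu x]
    exact ofReal_add_affine_identity _ _
  have hint : erealIntegral Q (fun x => θ (u x)) = ((∫⁻ x, f (u x) ∂Q : ℝ≥0∞) : EReal) +
      ((∫ x, l x ∂Q : ℝ) : EReal) := by
    rw [integral_eq_lintegral_pos_part_sub_lintegral_neg_part hli]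
    exact EReal.coe_ennreal_sub_eq_of_add_eq hB hp hn hadd
  have hl_int : ∫ x, l x ∂Q = α * (P.real Set.univ - Sg.toReal) + β * Q.real Set.univ := by
    rw [integral_add (hui.const_mul α) (integrable_const β), integral_const_mul, integral_const,
      Measure.integral_toReal_rnDeriv']
    simp only [smul_eq_mul, mul_comm, hSg]
    rfl
  have hSc : (Sg : EReal) = ((Sg.toReal : ℝ) : EReal) := by
    conv_lhs => rw [← ENNReal.ofReal_toReal hSfin]
    rw [EReal.coe_ennreal_ofReal, max_eq_left ENNReal.toReal_nonneg]
  have hsing : recessionSlope θ * (Sg : EReal) =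
      ((s * Sg : ℝ≥0∞) : EReal) + ((α * Sg.toReal : ℝ) : EReal) := by
    rw [hsR, EReal.right_distrib_of_nonneg_of_ne_top (EReal.coe_ennreal_nonneg _)
      (by rw [hSc]; exact EReal.coe_ne_top _),
      EReal.coe_ennreal_mul, EReal.coe_mul, ← hSc]
  rw [thetaDiv, hint, hsing, profileDiv, add_add_add_comm, ← EReal.coe_add, EReal.coe_ennreal_add,
    hl_int]
  congr 2
  ring

/-- The divergence as the integral of the perspective against `P + Q`. -/
theorem profileDiv_eq_lintegral {Ω : Type} [MeasurableSpace Ω]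
    {f : ℝ → ℝ≥0∞} {s : ℝ≥0∞} (hf : Measurable f)
    (P Q : Measure Ω) [IsFiniteMeasure P] [IsFiniteMeasure Q] :
    profileDiv f s P Q =
      ∫⁻ x, segmentPerspective f s ((P.rnDeriv (P + Q) x).toReal) ∂(P + Q) := by
  set M := P + Q with hM
  have hPM : P ≤ M := Measure.le_add_right le_rfl
  set p := P.rnDeriv M with hp
  have hpm : Measurable p := P.measurable_rnDeriv M
  have hP : M.withDensity p = P := Measure.withDensity_rnDeriv_eq _ _ hPM.absolutelyContinuous
  have hp1 : ∀ᵐ x ∂M, p x ≤ 1 := Measure.rnDeriv_le_one_of_le hPM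
  have hQ : M.withDensity (fun x => 1 - p x) = Q := by
    have hsum : M.withDensity p + M.withDensity (fun x => 1 - p x) = M := by
      rw [← withDensity_add_left hpm]
      conv_rhs => rw [← withDensity_one (μ := M)]
      refine withDensity_congr_ae ?_
      filter_upwards [hp1] with x hx
      simp [add_tsub_cancel_of_le hx]
    rw [hP] at hsum
    ext A hA
    have := congrArg (fun m => m A) (hsum.trans hM)
    simpa [measure_ne_top] using this
  set N := {x | p x = 1} with hN
  have hNm : MeasurableSet N := hpm (measurableSet_singleton 1)
  set r : Ω → ℝ≥0∞ := Nᶜ.indicator (fun x => p x / (1 - p x)) with hr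
  have hrm : Measurable r := by
    refine Measurable.indicator ?_ hNm.compl
    fun_prop
  have hQN : Q N = 0 := by
    rw [← hQ, withDensity_apply _ hNm, setLIntegral_congr_fun (g := 0) hNm]
    · simp
    · intro x hx
      have : p x = 1 := hx
      simp [this]
  have hsingN : P.restrict N ⟂ₘ Q := by
    refine ⟨Nᶜ, hNm.compl, ?_, by simpa using hQN⟩
    rw [Measure.restrict_apply hNm.compl]; simp
  have hdec : P = P.restrict N + Q.withDensity r := by
    have h1 : P.restrict N = M.withDensity (N.indicator p) := by
      rw [withDensity_indicator hNm, ← restrict_withDensity hNm, hP]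
    have h2 : Q.withDensity r = M.withDensity (fun x => (1 - p x) * r x) := by
      conv_lhs => rw [← hQ]
      exact (withDensity_mul _ (by fun_prop) hrm).symm
    rw [h1, h2, ← withDensity_add_left (hpm.indicator hNm)]
    conv_lhs => rw [← hP]
    refine withDensity_congr_ae ?_
    filter_upwards [hp1] with x hx
    by_cases hxN : x ∈ N
    · simp [hr, hxN]
    · have hlt : p x < 1 := lt_of_le_of_ne hx hxN
      simp only [Pi.add_apply, hr, Set.indicator_of_notMem hxN, Set.indicator_of_mem
        (Set.mem_compl hxN), zero_add]
      rw [ENNReal.mul_div_cancel (tsub_pos_of_lt hlt).ne' (by simp)]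
  have hrn : r =ᵐ[Q] P.rnDeriv Q := Measure.eq_rnDeriv hrm hsingN hdec
  have hsp : P.restrict N = P.singularPart Q := Measure.eq_singularPart hrm hsingN hdec
  have hF : ∫⁻ x, f ((P.rnDeriv Q x).toReal) ∂Q = ∫⁻ x, (1 - p x) * f (r x).toReal ∂M := by
    rw [lintegral_congr_ae (g := fun x => f (r x).toReal)
      (by filter_upwards [hrn] with x hx; rw [hx])]
    conv_lhs => rw [← hQ]
    rw [lintegral_withDensity_eq_lintegral_mul _ (by fun_prop) (by fun_prop)]
    rfl
  have hS : s * P.singularPart Q Set.univ = ∫⁻ x, N.indicator (fun _ => s) x ∂M := by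
    have hMN : M N = P N := by rw [hM, Measure.add_apply, hQN, add_zero]
    rw [← hsp, lintegral_indicator_const hNm, Measure.restrict_apply_univ, hMN]
  rw [profileDiv, hF, hS, ← lintegral_add_right _ (measurable_const.indicator hNm)]
  refine lintegral_congr_ae ?_
  filter_upwards [hp1] with x hx
  by_cases hxN : x ∈ N
  · have : p x = 1 := hxN
    simp [this, hxN, segmentPerspective]
  · have hlt : p x < 1 := lt_of_le_of_ne hx hxN
    have h1 : (p x).toReal ≠ 1 := by
      rwa [Ne, ENNReal.toReal_eq_one_iff]
    have h2 : (1 - p x).toReal = 1 - (p x).toReal := by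
      rw [ENNReal.toReal_sub_of_le hx ENNReal.one_ne_top, ENNReal.toReal_one]
    rw [segmentPerspective, if_neg h1, ← h2, ENNReal.ofReal_toReal (by simp)]
    simp [hr, hxN]

end Divergence

section DataProcessing

/-- Strict Jensen inequality for `ℝ≥0∞`-valued strictly convex functions on `[0,1]`. -/
theorem ENNStrictConvexOn.jensen {Ω : Type} [MeasurableSpace Ω] {φ : ℝ → ℝ≥0∞}
    (hφm : Measurable φ) (hφ : ENNStrictConvexOn (Set.Icc 0 1) φ)
    (κ : Measure Ω) [IsProbabilityMeasure κ] {p : Ω → ℝ≥0∞} (hpm : Measurable p)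
    (hp1 : ∀ᵐ x ∂κ, p x ≤ 1) :
    φ (∫⁻ x, p x ∂κ).toReal ≤ ∫⁻ x, φ (p x).toReal ∂κ ∧
      (∫⁻ x, φ (p x).toReal ∂κ ≠ ⊤ → φ (∫⁻ x, p x ∂κ).toReal = ∫⁻ x, φ (p x).toReal ∂κ →
        ∀ᵐ x ∂κ, p x = ∫⁻ x, p x ∂κ) := by
  set t : Ω → ℝ := fun x => (p x).toReal with ht
  have htm : Measurable t := hpm.ennreal_toReal
  have ht01 : ∀ᵐ x ∂κ, t x ∈ Set.Icc (0 : ℝ) 1 := by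
    filter_upwards [hp1] with x hx
    exact ⟨ENNReal.toReal_nonneg, by simpa using ENNReal.toReal_mono ENNReal.one_ne_top hx⟩
  have hti : Integrable t κ := by
    refine Integrable.of_bound htm.aestronglyMeasurable 1 ?_
    filter_upwards [ht01] with x hx
    rw [Real.norm_of_nonneg hx.1]
    exact hx.2
  have hpfin : ∫⁻ x, p x ∂κ ≠ ⊤ := by
    refine ne_top_of_le_ne_top ENNReal.one_ne_top ((lintegral_mono_ae hp1).trans ?_)
    simp
  set m : ℝ := (∫⁻ x, p x ∂κ).toReal with hm
  have hmt : ∫ x, t x ∂κ = m := by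
    rw [hm, ← integral_toReal hpm.aemeasurable]
    filter_upwards [hp1] with x hx
    exact hx.trans_lt ENNReal.one_lt_top
  have hpt : (∀ᵐ x ∂κ, t x = m) → ∀ᵐ x ∂κ, p x = ∫⁻ x, p x ∂κ := by
    intro h
    filter_upwards [h, hp1] with x hx hx1
    exact (ENNReal.toReal_eq_toReal_iff' (ne_top_of_le_ne_top ENNReal.one_ne_top hx1) hpfin).1 hx
  by_cases hconst : ∀ᵐ x ∂κ, t x = m
  · have : ∫⁻ x, φ (t x) ∂κ = φ m := by
      rw [lintegral_congr_ae (g := fun _ => φ m) (by filter_upwards [hconst] with x hx; rw [hx])]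
      simp
    exact ⟨this.ge, fun _ _ => hpt hconst⟩
  by_cases hfin : ∫⁻ x, φ (t x) ∂κ = ⊤
  · exact ⟨by rw [hfin]; exact le_top, fun h => absurd hfin h⟩
  suffices hlt : φ m < ∫⁻ x, φ (t x) ∂κ from ⟨hlt.le, fun _ h => absurd h hlt.ne⟩
  set J : Set ℝ := {x | x ∈ Set.Icc (0 : ℝ) 1 ∧ φ x ≠ ⊤} with hJ
  have hg := hφ.strictConvexOn_toReal (convex_Icc 0 1)
  have htJ : ∀ᵐ x ∂κ, t x ∈ J := by
    filter_upwards [ht01, ae_lt_top (hφm.comp htm) hfin] with x hx hx'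
    exact ⟨hx, hx'.ne⟩
  obtain ⟨a, haJ, ham⟩ : ∃ a ∈ J, a < m := by
    by_contra hcon
    push Not at hcon
    refine hconst ?_
    have h0 : 0 ≤ᵐ[κ] fun x => t x - m := by
      filter_upwards [htJ] with x hx
      exact sub_nonneg.2 (hcon _ hx)
    have hint : ∫ x, (t x - m) ∂κ = 0 := by
      rw [integral_sub hti (integrable_const m), hmt]; simp
    filter_upwards [(integral_eq_zero_iff_of_nonneg_ae h0 (hti.sub (integrable_const m))).1 hint]
      with x hx
    exact sub_eq_zero.1 hx
  obtain ⟨b, hbJ, hmb⟩ : ∃ b ∈ J, m < b := by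
    by_contra hcon
    push Not at hcon
    refine hconst ?_
    have h0 : 0 ≤ᵐ[κ] fun x => m - t x := by
      filter_upwards [htJ] with x hx
      exact sub_nonneg.2 (hcon _ hx)
    have hint : ∫ x, (m - t x) ∂κ = 0 := by
      rw [integral_sub (integrable_const m) hti, hmt]; simp
    filter_upwards [(integral_eq_zero_iff_of_nonneg_ae h0 ((integrable_const m).sub hti)).1 hint]
      with x hx
    exact (sub_eq_zero.1 hx).symm
  obtain ⟨k, hk⟩ := hg.exists_strict_support haJ hbJ ham hmb
  have hmJ : m ∈ J := hg.1.ordConnected.out haJ hbJ ⟨ham.le, hmb.le⟩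
  set g : ℝ → ℝ := fun x => (φ x).toReal with hgdef
  have hgi : Integrable (fun x => g (t x)) κ :=
    integrable_toReal_of_lintegral_ne_top (hφm.comp htm).aemeasurable hfin
  have hli : Integrable (fun x => g m + k * (t x - m)) κ :=
    (integrable_const _).add ((hti.sub (integrable_const m)).const_mul k)
  have hdi : Integrable (fun x => g (t x) - (g m + k * (t x - m))) κ := hgi.sub hli
  have hnn : 0 ≤ᵐ[κ] fun x => g (t x) - (g m + k * (t x - m)) := by
    filter_upwards [htJ] with x hx
    rcases eq_or_ne (t x) m with h | h
    · simp [h]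
    · exact sub_nonneg.2 (hk _ hx h).le
  have hpos : 0 < ∫ x, (g (t x) - (g m + k * (t x - m))) ∂κ := by
    refine lt_of_le_of_ne (integral_nonneg_of_ae hnn) fun h0 => hconst ?_
    filter_upwards [(integral_eq_zero_iff_of_nonneg_ae hnn hdi).1 h0.symm, htJ] with x hx hxJ
    by_contra hne
    have h1 := hk _ hxJ hne
    have h2 : g (t x) - (g m + k * (t x - m)) = 0 := hx
    linarith
  have hlint : ∫ x, (g m + k * (t x - m)) ∂κ = g m := by
    have h1 : Integrable (fun x => k * (t x - m)) κ := (hti.sub (integrable_const m)).const_mul k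
    rw [integral_add (integrable_const _) h1, integral_const_mul,
      integral_sub hti (integrable_const m), hmt]
    simp
  rw [integral_sub hgi hli, hlint, sub_pos] at hpos
  have hgt : ∫ x, g (t x) ∂κ = (∫⁻ x, φ (t x) ∂κ).toReal :=
    integral_toReal (hφm.comp htm).aemeasurable (ae_lt_top (hφm.comp htm) hfin)
  rw [hgt] at hpos
  exact (ENNReal.toReal_lt_toReal hmJ.2 hfin).1 hpos

theorem MeasureTheory.Measure.withDensity_compProd_left {α Ω : Type} [MeasurableSpace α]
    [MeasurableSpace Ω]
    (μ : Measure α) [IsFiniteMeasure μ] (K : Kernel α Ω) [IsMarkovKernel K] {g : α → ℝ≥0∞}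
    (hg : Measurable g) [IsFiniteMeasure (μ.withDensity g)] :
    (μ.withDensity g) ⊗ₘ K = (μ ⊗ₘ K).withDensity (fun z => g z.1) := by
  ext A hA
  have hKA : Measurable fun y => K y (Prod.mk y ⁻¹' A) :=
    Kernel.measurable_kernel_prodMk_left hA
  rw [Measure.compProd_apply hA, lintegral_withDensity_eq_lintegral_mul _ hg hKA,
    withDensity_apply _ hA, ← lintegral_indicator hA,
    Measure.lintegral_compProd (f := A.indicator fun z => g z.1)
      ((hg.comp measurable_fst).indicator hA)]
  refine lintegral_congr fun y => ?_
  have : (fun x => A.indicator (fun z : α × Ω => g z.1) (y, x)) =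
      (Prod.mk y ⁻¹' A).indicator (fun _ => g y) := by
    ext x
    by_cases h : (y, x) ∈ A <;> simp [Set.indicator, h]
  rw [this, lintegral_indicator_const (measurable_prodMk_left hA)]
  rfl

/-- Data processing for the first projection, with its equality case. -/
theorem StrictConvexProfile.profileDiv_fst_le {α Ω : Type} [MeasurableSpace α]
    [MeasurableSpace Ω] [StandardBorelSpace Ω] [Nonempty Ω] {f : ℝ → ℝ≥0∞} {s : ℝ≥0∞}
    (hf : StrictConvexProfile f s) (π ρ : Measure (α × Ω)) [IsFiniteMeasure π]
    [IsFiniteMeasure ρ] :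
    profileDiv f s π.fst ρ.fst ≤ profileDiv f s π ρ ∧
      (profileDiv f s π ρ ≠ ⊤ → profileDiv f s π ρ ≤ profileDiv f s π.fst ρ.fst →
        ∃ K : Kernel α Ω, IsMarkovKernel K ∧ π = π.fst ⊗ₘ K ∧ ρ = ρ.fst ⊗ₘ K) := by
  set M := π + ρ with hM
  set φ := segmentPerspective f s with hφdef
  have hφm : Measurable φ := measurable_segmentPerspective s hf.measurable
  have hφ := hf.segmentPerspective_strict
  have hπM : π ≤ M := Measure.le_add_right le_rfl
  have hfst : M.fst = π.fst + ρ.fst := by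
    simp only [Measure.fst, hM]
    exact Measure.map_add _ _ measurable_fst
  set K := M.condKernel with hK
  have hMK : M.fst ⊗ₘ K = M := M.disintegrate K
  set p := π.rnDeriv M with hp
  have hpm : Measurable p := π.measurable_rnDeriv M
  have hπ : M.withDensity p = π := Measure.withDensity_rnDeriv_eq _ _ hπM.absolutelyContinuous
  have hp1 : ∀ᵐ z ∂M, p z ≤ 1 := Measure.rnDeriv_le_one_of_le hπM
  have hp1' : ∀ᵐ y ∂M.fst, ∀ᵐ x ∂(K y), p (y, x) ≤ 1 := by
    refine Measure.ae_ae_of_ae_compProd (μ := M.fst) (κ := K) (p := fun z => p z ≤ 1) ?_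
    rwa [hMK]
  set q : α → ℝ≥0∞ := fun y => ∫⁻ x, p (y, x) ∂(K y) with hq
  have hqm : Measurable q := Measurable.lintegral_kernel_prod_right' (κ := K) hpm
  have hπfst : π.fst = M.fst.withDensity q := by
    ext A hA
    rw [Measure.fst_apply hA, withDensity_apply _ hA]
    conv_lhs => rw [← hπ]
    rw [withDensity_apply _ (measurable_fst hA)]
    conv_lhs => rw [← hMK]
    rw [← Set.prod_univ, Measure.setLIntegral_compProd hpm hA MeasurableSet.univ]
    simp [hq]
  have hqd : π.fst.rnDeriv M.fst =ᵐ[M.fst] q := by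
    conv_lhs => rw [hπfst]
    exact Measure.rnDeriv_withDensity _ hqm
  have hD1 : profileDiv f s π ρ = ∫⁻ y, ∫⁻ x, φ (p (y, x)).toReal ∂(K y) ∂M.fst := by
    rw [profileDiv_eq_lintegral hf.measurable, ← hM]
    conv_lhs => rw [← hMK]
    rw [hMK, ← hp, ← hφdef]
    conv_lhs => rw [← hMK]
    rw [Measure.lintegral_compProd (f := fun z => φ (p z).toReal) (hφm.comp hpm.ennreal_toReal)]
  have hD2 : profileDiv f s π.fst ρ.fst = ∫⁻ y, φ (q y).toReal ∂M.fst := by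
    rw [profileDiv_eq_lintegral hf.measurable, ← hfst]
    refine lintegral_congr_ae ?_
    filter_upwards [hqd] with y hy
    rw [hy]
  have hjen : ∀ᵐ y ∂M.fst, φ (q y).toReal ≤ ∫⁻ x, φ (p (y, x)).toReal ∂(K y) ∧
      (∫⁻ x, φ (p (y, x)).toReal ∂(K y) ≠ ⊤ →
        φ (q y).toReal = ∫⁻ x, φ (p (y, x)).toReal ∂(K y) → ∀ᵐ x ∂(K y), p (y, x) = q y) := by
    filter_upwards [hp1'] with y hy
    exact hφ.jensen hφm (K y) (hpm.comp measurable_prodMk_left) hy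
  have hinm : Measurable fun y => ∫⁻ x, φ (p (y, x)).toReal ∂(K y) :=
    Measurable.lintegral_kernel_prod_right' (κ := K) (hφm.comp hpm.ennreal_toReal)
  refine ⟨?_, fun hfin hle => ?_⟩
  · rw [hD1, hD2]
    exact lintegral_mono_ae (hjen.mono fun y h => h.1)
  · rw [hD1] at hfin
    rw [hD1, hD2] at hle
    have hfin2 : ∫⁻ y, φ (q y).toReal ∂M.fst ≠ ⊤ :=
      ne_top_of_le_ne_top hfin (lintegral_mono_ae (hjen.mono fun y h => h.1))
    have heq := ae_eq_of_ae_le_of_lintegral_le (hjen.mono fun y h => h.1) hfin2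
      hinm.aemeasurable hle
    have hpq : ∀ᵐ z ∂M, p z = q z.1 := by
      rw [← hMK]
      refine Measure.ae_compProd_of_ae_ae (measurableSet_eq_fun hpm (hqm.comp measurable_fst)) ?_
      filter_upwards [hjen, heq, ae_lt_top hinm hfin] with y hy hy' hy''
      exact hy.2 hy''.ne hy'
    have hρ : M.withDensity (fun z => 1 - p z) = ρ := by
      have hsum : M.withDensity p + M.withDensity (fun x => 1 - p x) = M := by
        rw [← withDensity_add_left hpm]
        conv_rhs => rw [← withDensity_one (μ := M)]
        refine withDensity_congr_ae ?_
        filter_upwards [hp1] with x hx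
        simp [add_tsub_cancel_of_le hx]
      rw [hπ] at hsum
      ext A hA
      have := congrArg (fun m => m A) (hsum.trans hM)
      simpa [measure_ne_top] using this
    have hfinq : IsFiniteMeasure (M.fst.withDensity q) := by rw [← hπfst]; infer_instance
    have hfinq' : IsFiniteMeasure (M.fst.withDensity (fun y => 1 - q y)) := by
      refine isFiniteMeasure_withDensity (ne_top_of_le_ne_top (measure_ne_top M.fst Set.univ) ?_)
      calc ∫⁻ y, (1 - q y) ∂M.fst ≤ ∫⁻ _, 1 ∂M.fst := lintegral_mono fun y => tsub_le_self
        _ = _ := by simp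
    have hπK : π = (M.fst.withDensity q) ⊗ₘ K := by
      rw [Measure.withDensity_compProd_left _ _ hqm, hMK, ← withDensity_congr_ae hpq, hπ]
    have hρK : ρ = (M.fst.withDensity (fun y => 1 - q y)) ⊗ₘ K := by
      rw [Measure.withDensity_compProd_left _ _ (by fun_prop), hMK]
      conv_lhs => rw [← hρ]
      refine withDensity_congr_ae ?_
      filter_upwards [hpq] with z hz
      rw [hz]
    refine ⟨K, inferInstance, ?_, ?_⟩
    · rw [hπfst]; exact hπK
    · conv_rhs => rw [hρK, Measure.fst_compProd]
      exact hρK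

/-- Composition with a common Markov kernel preserves the divergence. -/
theorem thetaDiv_compProd {α Ω : Type} [MeasurableSpace α]
    [MeasurableSpace Ω] {θ : ℝ → EReal} (hθ : ProperConvexLSCOn θ) (P Q : Measure α)
    [IsFiniteMeasure P] [IsFiniteMeasure Q] (K : Kernel α Ω) [IsMarkovKernel K] :
    thetaDiv θ (P ⊗ₘ K) (Q ⊗ₘ K) = thetaDiv θ P Q := by
  set r := P.rnDeriv Q with hr
  have hrm : Measurable r := P.measurable_rnDeriv Q
  have hsing : (P.singularPart Q) ⊗ₘ K ⟂ₘ Q ⊗ₘ K :=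
    (Measure.mutuallySingular_singularPart P Q).compProd_of_left K K
  have hdec : P ⊗ₘ K = (P.singularPart Q) ⊗ₘ K + (Q ⊗ₘ K).withDensity (fun z => r z.1) := by
    rw [← Measure.withDensity_compProd_left _ _ hrm, ← Measure.compProd_add_left,
      Measure.singularPart_add_rnDeriv]
  have hrd := Measure.eq_rnDeriv (hrm.comp measurable_fst) hsing hdec
  have hsp := Measure.eq_singularPart (hrm.comp measurable_fst) hsing hdec
  have hint : ∀ G : EReal → ℝ≥0∞, Measurable G →
      ∫⁻ z, G (θ (((P ⊗ₘ K).rnDeriv (Q ⊗ₘ K) z).toReal)) ∂(Q ⊗ₘ K) =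
        ∫⁻ y, G (θ ((r y).toReal)) ∂Q := by
    intro G hG
    have hm : Measurable fun y => G (θ ((r y).toReal)) := by
      have := hG.comp (hθ.measurable_comp_max.comp hrm.ennreal_toReal)
      simpa [Function.comp_def] using this
    rw [lintegral_congr_ae (g := fun z => G (θ ((r z.1).toReal)))
      (by filter_upwards [hrd] with z hz; rw [← hz]; rfl)]
    rw [Measure.lintegral_compProd (f := fun z => G (θ ((r z.1).toReal))) (hm.comp measurable_fst)]
    simp
  have hmeas : Measurable erealToENNReal := measurable_ereal_toENNReal
  rw [thetaDiv, thetaDiv, ← hsp, Measure.compProd_apply_univ, erealIntegral, erealIntegral,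
    hint _ hmeas, hint (fun z => erealToENNReal (-z)) (hmeas.comp measurable_neg)]

/-- Two finite measures concentrated on `E` can be disintegrated so that a single kernel
represents the first one and stays in `E` almost surely for the marginal of the second. -/
theorem exists_common_response_kernel {α Ω : Type} [MeasurableSpace α]
    [MeasurableSpace Ω] [StandardBorelSpace Ω] [Nonempty Ω] {E : Set (α × Ω)}
    (hE : MeasurableSet E) (π ρ : Measure (α × Ω)) [IsFiniteMeasure π] [IsFiniteMeasure ρ]
    (hπ : π Eᶜ = 0) (hρ : ρ Eᶜ = 0) :
    ∃ K : Kernel α Ω, IsMarkovKernel K ∧ π = π.fst ⊗ₘ K ∧ (ρ.fst ⊗ₘ K) Eᶜ = 0 := by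
  classical
  set S : Set α := {y | π.condKernel y (Prod.mk y ⁻¹' Eᶜ) = 0} with hS
  have hSm : MeasurableSet S :=
    Kernel.measurable_kernel_prodMk_left hE.compl (measurableSet_singleton 0)
  have key : ∀ (μ : Measure (α × Ω)) [IsFiniteMeasure μ], μ Eᶜ = 0 →
      ∀ᵐ y ∂μ.fst, μ.condKernel y (Prod.mk y ⁻¹' Eᶜ) = 0 := by
    intro μ _ h
    have h' : (μ.fst ⊗ₘ μ.condKernel) Eᶜ = 0 := by rwa [μ.disintegrate μ.condKernel]
    rw [Measure.compProd_apply hE.compl, lintegral_eq_zero_iff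
      (Kernel.measurable_kernel_prodMk_left hE.compl)] at h'
    exact h'
  refine ⟨Kernel.piecewise hSm π.condKernel ρ.condKernel, inferInstance, ?_, ?_⟩
  · conv_lhs => rw [← π.disintegrate π.condKernel]
    refine Measure.compProd_congr ?_
    filter_upwards [key π hπ] with y hy
    rw [Kernel.piecewise_apply, if_pos (show y ∈ S from hy)]
  · rw [Measure.compProd_apply hE.compl, lintegral_eq_zero_iff
      (Kernel.measurable_kernel_prodMk_left hE.compl)]
    filter_upwards [key ρ hρ] with y hy
    rw [Kernel.piecewise_apply]
    by_cases h : y ∈ S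
    · rw [if_pos h]; exact h
    · rw [if_neg h]; exact hy

end DataProcessing

section ProportionalResponse

theorem thetaDiv_map_measurableEquiv {α β : Type} [MeasurableSpace α] [MeasurableSpace β]
    (θ : ℝ → EReal) (e : α ≃ᵐ β) (P Q : Measure α) [IsFiniteMeasure P] [IsFiniteMeasure Q] :
    thetaDiv θ (P.map e) (Q.map e) = thetaDiv θ P Q := by
  have h := e.measurableEmbedding.rnDeriv_map P Q
  have hint : ∀ G : EReal → ℝ≥0∞,
      ∫⁻ z, G (θ (((P.map e).rnDeriv (Q.map e) z).toReal)) ∂(Q.map e) =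
        ∫⁻ y, G (θ ((P.rnDeriv Q y).toReal)) ∂Q := by
    intro G
    rw [lintegral_map_equiv]
    refine lintegral_congr_ae ?_
    filter_upwards [h] with y hy
    rw [← hy]
  rw [thetaDiv, thetaDiv, e.measurableEmbedding.singularPart_map, erealIntegral, erealIntegral,
    hint, hint (fun z => erealToENNReal (-z)), Measure.map_apply e.measurable MeasurableSet.univ,
    Set.preimage_univ]

theorem mix_eq_map_swap_compProd (η : Measure Y) [IsFiniteMeasure η] (L : Kernel Y X)
    [IsMarkovKernel L] : mix η L = (η ⊗ₘ L).map Prod.swap := by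
  have happ : ∀ A : Set (X × Y), MeasurableSet A → ∀ y,
      ((L y).map fun x => (x, y)) A = L y (Prod.mk y ⁻¹' (Prod.swap ⁻¹' A)) := by
    intro A hA y
    rw [Measure.map_apply measurable_prodMk_right hA]
    rfl
  have hm : Measurable fun y => (L y).map fun x => (x, y) := by
    refine Measure.measurable_of_measurable_coe _ fun A hA => ?_
    simp_rw [happ A hA]
    exact Kernel.measurable_kernel_prodMk_left (measurable_swap hA)
  ext A hA
  rw [mix, Measure.bind_apply hA hm.aemeasurable, Measure.map_apply measurable_swap hA,
    Measure.compProd_apply (measurable_swap hA)]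
  exact lintegral_congr fun y => happ A hA y

theorem MeasureTheory.Measure.fst_map_swap_eq_map_snd (π : Measure (X × Y)) :
    (π.map Prod.swap).fst = π.map Prod.snd := by
  rw [Measure.fst, Measure.map_map measurable_fst measurable_swap]
  rfl

theorem MeasureTheory.Measure.map_swap_map_swap (π : Measure (X × Y)) :
    (π.map Prod.swap).map Prod.swap = π := by
  rw [Measure.map_map measurable_swap measurable_swap]
  simp

theorem MeasureTheory.Measure.map_swap_apply_preimage_swap_compl {E : Set (X × Y)}
    (hE : MeasurableSet E) (π : Measure (X × Y)) :
    (π.map Prod.swap) (Prod.swap ⁻¹' E)ᶜ = π Eᶜ := by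
  rw [Measure.map_apply measurable_swap (measurable_swap hE).compl]
  rfl

/-- Every plan admits a response whose divergence is the divergence of the opposite marginals. -/
theorem exists_plansSnd_thetaDiv_eq [StandardBorelSpace X] [Nonempty X] {E : Set (X × Y)}
    (hE : MeasurableSet E) {θ : ℝ → EReal} (hθ : ProperConvexLSCOn θ) {νX : Measure X}
    {νY : Measure Y} {π ρ : Measure (X × Y)} (hπ : π ∈ Plans E νX) (hρ : ρ ∈ PlansSnd E νY) :
    ∃ ρ' ∈ PlansSnd E νY, thetaDiv θ π ρ' = thetaDiv θ (π.map Prod.snd) νY := by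
  obtain ⟨hπf, hπE, -⟩ := hπ
  obtain ⟨hρf, hρE, hρY⟩ := hρ
  obtain ⟨K, hK, hπK, hρK⟩ := exists_common_response_kernel (measurable_swap hE)
    (π.map Prod.swap) (ρ.map Prod.swap)
    (by rwa [Measure.map_swap_apply_preimage_swap_compl hE])
    (by rwa [Measure.map_swap_apply_preimage_swap_compl hE])
  rw [Measure.fst_map_swap_eq_map_snd] at hπK
  rw [Measure.fst_map_swap_eq_map_snd, hρY] at hρK
  have hνf : IsFiniteMeasure νY := by rw [← hρY]; infer_instance
  refine ⟨(νY ⊗ₘ K).map Prod.swap, ⟨inferInstance, ?_, ?_⟩, ?_⟩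
  · rw [Measure.map_apply measurable_swap hE.compl]
    exact hρK
  · rw [← Measure.fst_map_swap_eq_map_snd, Measure.map_swap_map_swap, Measure.fst_compProd]
  · have h := thetaDiv_map_measurableEquiv θ MeasurableEquiv.prodComm
      ((π.map Prod.snd) ⊗ₘ K) (νY ⊗ₘ K)
    rw [thetaDiv_compProd hθ] at h
    rw [← h, ← hπK]
    congr 1
    exact (Measure.map_swap_map_swap π).symm

theorem isPropResponse_of_compProd {E : Set (X × Y)} (hE : MeasurableSet E) {νY : Measure Y}
    [IsFiniteMeasure νY] {π π' : Measure (X × Y)} [IsFiniteMeasure π] (hπ'E : π' Eᶜ = 0)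
    {K : Kernel Y X} [IsMarkovKernel K]
    (hπ : π = ((π.map Prod.snd) ⊗ₘ K).map Prod.swap) (hπ' : π' = (νY ⊗ₘ K).map Prod.swap) :
    IsPropResponse E νY π π' := by
  refine ⟨K, inferInstance, K, inferInstance, ?_, ?_, ?_⟩
  · rw [mix_eq_map_swap_compProd, ← hπ]
  · have h : ∀ᵐ y ∂νY, K y (Prod.mk y ⁻¹' (Prod.swap ⁻¹' E)ᶜ) = 0 := by
      rw [hπ', Measure.map_apply measurable_swap hE.compl, Set.preimage_compl,
        Measure.compProd_apply (measurable_swap hE).compl, lintegral_eq_zero_iff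
        (Kernel.measurable_kernel_prodMk_left (measurable_swap hE).compl)] at hπ'E
      exact hπ'E
    filter_upwards [(Measure.absolutelyContinuous_of_le (Measure.singularPart_le νY _)).ae_le h]
      with y hy
    rw [Set.preimage_compl] at hy
    exact (prob_compl_eq_zero_iff (measurable_prodMk_left (measurable_swap hE))).1 hy
  · rw [mix_eq_map_swap_compProd, mix_eq_map_swap_compProd, ← Measure.map_add _ _ measurable_swap,
      ← Measure.compProd_add_left, Measure.rnDeriv_add_singularPart]
    exact hπ'

/-- A pair of plans whose divergence does not exceed that of the opposite marginals consists of
a plan and a proportional response to it. -/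
theorem isPropResponse_of_thetaDiv_le [StandardBorelSpace X] [Nonempty X] {E : Set (X × Y)}
    (hE : MeasurableSet E) {θ : ℝ → EReal} (hθ : ProperConvexLSCOn θ)
    (hs : StrictlyConvexOnDom θ) {νX : Measure X}
    {νY : Measure Y} [IsFiniteMeasure νY] {π ρ : Measure (X × Y)} (hπ : π ∈ Plans E νX)
    (hρ : ρ ∈ PlansSnd E νY) (hfin : thetaDiv θ π ρ ≠ ⊤)
    (hle : thetaDiv θ π ρ ≤ thetaDiv θ (π.map Prod.snd) νY) :
    IsPropResponse E νY π ρ ∧ thetaDiv θ π ρ = thetaDiv θ (π.map Prod.snd) νY := by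
  obtain ⟨hπf, hπE, -⟩ := hπ
  obtain ⟨hρf, hρE, hρY⟩ := hρ
  obtain ⟨α, β, hαβ⟩ := hs.exists_minorant hθ
  obtain ⟨f, s, hf, hfθ, hsR⟩ := hs.exists_profile hθ hαβ
  have hswap : thetaDiv θ (π.map Prod.swap) (ρ.map Prod.swap) = thetaDiv θ π ρ :=
    thetaDiv_map_measurableEquiv θ MeasurableEquiv.prodComm π ρ
  rw [← hswap] at hfin hle
  have e1 := thetaDiv_eq_profileDiv_add hf.measurable hfθ hsR (π.map Prod.swap) (ρ.map Prod.swap)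
  have e2 := thetaDiv_eq_profileDiv_add hf.measurable hfθ hsR
    (π.map Prod.swap).fst (ρ.map Prod.swap).fst
  have hdp := hf.profileDiv_fst_le (π.map Prod.swap) (ρ.map Prod.swap)
  have m1 : (π.map Prod.swap).fst.real Set.univ = (π.map Prod.swap).real Set.univ := by
    simp only [Measure.real, Measure.fst_univ]
  have m2 : (ρ.map Prod.swap).fst.real Set.univ = (ρ.map Prod.swap).real Set.univ := by
    simp only [Measure.real, Measure.fst_univ]
  rw [m1, m2] at e2
  rw [← hρY, ← Measure.fst_map_swap_eq_map_snd, ← Measure.fst_map_swap_eq_map_snd] at hle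
  have hpf : profileDiv f s (π.map Prod.swap) (ρ.map Prod.swap) ≠ ⊤ := by
    intro h
    rw [e1, h] at hfin
    exact hfin (by rw [EReal.coe_ennreal_top]; exact EReal.top_add_coe _)
  have hpl : profileDiv f s (π.map Prod.swap) (ρ.map Prod.swap) ≤
      profileDiv f s (π.map Prod.swap).fst (ρ.map Prod.swap).fst := by
    rw [e1, e2] at hle
    exact EReal.coe_ennreal_le_coe_ennreal_iff.1
      ((EReal.addLECancellable_coe _).add_le_add_iff_right.1 hle)
  obtain ⟨K, hK, hπK, hρK⟩ := hdp.2 hpf hpl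
  refine ⟨?_, ?_⟩
  · have : π = ((π.map Prod.snd) ⊗ₘ K).map Prod.swap := by
      rw [← Measure.fst_map_swap_eq_map_snd, ← hπK, Measure.map_swap_map_swap]
    refine isPropResponse_of_compProd hE hρE this ?_
    rw [← hρY, ← Measure.fst_map_swap_eq_map_snd, ← hρK, Measure.map_swap_map_swap]
  · rw [← hswap, e1, ← hρY, ← Measure.fst_map_swap_eq_map_snd, ← Measure.fst_map_swap_eq_map_snd,
      e2, le_antisymm hpl hdp.1]

end ProportionalResponse

section LevelOptimality

theorem MeasureTheory.withDensity_le_self {α : Type} [MeasurableSpace α] (μ : Measure α)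
    {w : α → ℝ≥0∞} (hw : ∀ x, w x ≤ 1) : μ.withDensity w ≤ μ := by
  conv_rhs => rw [← withDensity_one (μ := μ)]
  exact withDensity_mono (ae_of_all _ hw)

theorem MeasureTheory.Measure.map_withDensity_comp {α β : Type} [MeasurableSpace α]
    [MeasurableSpace β] (μ : Measure α) {g : α → β} (hg : Measurable g) {h : β → ℝ≥0∞}
    (hh : Measurable h) :
    (μ.withDensity fun x => h (g x)).map g = (μ.map g).withDensity h := by
  ext A hA
  rw [Measure.map_apply hg hA, withDensity_apply _ (hg hA), withDensity_apply _ hA,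
    setLIntegral_map hA hh hg]

theorem MeasureTheory.Measure.rnDeriv_mono {α : Type} [MeasurableSpace α] {μ ν : Measure α}
    (Q : Measure α) [IsFiniteMeasure μ] [IsFiniteMeasure ν] [SigmaFinite Q] (h : μ ≤ ν) :
    μ.rnDeriv Q ≤ᵐ[Q] ν.rnDeriv Q := by
  have hadd := Measure.rnDeriv_add' (ν - μ) μ Q
  rw [Measure.sub_add_cancel_of_le h] at hadd
  filter_upwards [hadd] with x hx
  rw [hx]
  exact le_add_self

theorem lintegral_mul_ne_zero_of_measure_univ_lt {α : Type} [MeasurableSpace α] (μ : Measure α)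
    {a b : α → ℝ≥0∞} (ham : Measurable a) (hbm : Measurable b) (ha : ∀ x, a x ≤ 1)
    (hb : ∀ x, b x ≤ 1) (h : μ Set.univ < ∫⁻ x, a x ∂μ + ∫⁻ x, b x ∂μ) :
    ∫⁻ x, a x * b x ∂μ ≠ 0 := by
  intro h0
  have h0' := (lintegral_eq_zero_iff (f := fun x => a x * b x) (ham.mul hbm)).1 h0
  refine h.not_ge ?_
  rw [← lintegral_add_left ham]
  calc ∫⁻ x, (a x + b x) ∂μ ≤ ∫⁻ _, 1 ∂μ := by
        refine lintegral_mono_ae ?_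
        filter_upwards [h0'] with x hx
        rcases mul_eq_zero.1 hx with hx | hx
        · simpa [hx] using hb x
        · simpa [hx] using ha x
    _ = μ Set.univ := by simp

/-- Truncating the opposite marginal of a plan at level `t` is realized by a feasible subplan. -/
theorem lintegral_min_rnDeriv_le_fit {E : Set (X × Y)} {νX : Measure X}
    {νY : Measure Y} [IsFiniteMeasure νY] {π : Measure (X × Y)} (hπ : π ∈ Plans E νX) (t : ℝ) :
    ∫⁻ y, min ((π.map Prod.snd).rnDeriv νY y) (ENNReal.ofReal t) ∂νY ≤ Fit E νX νY t := by
  obtain ⟨hπf, hπE, hπX⟩ := hπ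
  set P := π.map Prod.snd with hP
  set r := P.rnDeriv νY with hr
  have hrm : Measurable r := P.measurable_rnDeriv νY
  set T := ENNReal.ofReal t with hT
  set hms := Measure.mutuallySingular_singularPart P νY
  set N := hms.nullSet
  have hNm : MeasurableSet N := hms.measurableSet_nullSet
  set w : Y → ℝ≥0∞ := N.indicator fun y => min 1 (T / r y) with hw
  have hwm : Measurable w := (measurable_const.min (measurable_const.div hrm)).indicator hNm
  have hw1 : ∀ y, w y ≤ 1 := fun y =>
    (Set.indicator_le_self' (fun _ _ => zero_le) y).trans (min_le_left _ _)
  set σ := π.withDensity fun z => w z.2 with hσ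
  have hσle : σ ≤ π := withDensity_le_self π fun z => hw1 z.2
  have hσf : IsFiniteMeasure σ := isFiniteMeasure_of_le π hσle
  have hσY : σ.map Prod.snd = νY.withDensity fun y => min (r y) T := by
    rw [hσ, Measure.map_withDensity_comp π measurable_snd hwm, ← hP]
    conv_lhs => rw [← Measure.singularPart_add_rnDeriv P νY]
    rw [withDensity_add_measure, ← withDensity_mul _ hrm hwm]
    have h0 : (P.singularPart νY).withDensity w = 0 := by
      rw [withDensity_eq_zero_iff hwm.aemeasurable]
      have : ∀ᵐ y ∂(P.singularPart νY), y ∉ N := by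
        rw [ae_iff]; simp only [not_not]; exact hms.measure_nullSet
      filter_upwards [this] with y hy
      simp [hw, hy]
    rw [h0, zero_add]
    refine withDensity_congr_ae ?_
    have : ∀ᵐ y ∂νY, y ∈ N := by rw [ae_iff]; exact hms.measure_compl_nullSet
    filter_upwards [this, Measure.rnDeriv_lt_top P νY] with y hy hy'
    change r y * w y = min (r y) T
    rw [hw, Set.indicator_of_mem hy]
    rcases eq_or_ne (r y) 0 with h | h
    · simp [h]
    · rw [mul_min, mul_one, ENNReal.mul_div_cancel h hy'.ne]
  have hmem : σ ∈ Feas E νX νY t := by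
    refine ⟨hσf, Measure.absolutelyContinuous_of_le hσle hπE, ?_, ?_⟩
    · rw [← hπX]; exact Measure.map_mono hσle measurable_fst
    · rw [hσY, ← withDensity_const]
      exact withDensity_mono (ae_of_all _ fun y => min_le_right _ _)
  refine le_trans (le_of_eq ?_)
    (le_iSup₂ (f := fun σ (_ : σ ∈ Feas E νX νY t) => σ Set.univ) σ hmem)
  have : σ Set.univ = (σ.map Prod.snd) Set.univ := by
    rw [Measure.map_apply measurable_snd MeasurableSet.univ, Set.preimage_univ]
  rw [this, hσY, withDensity_apply _ MeasurableSet.univ, Measure.restrict_univ]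

/-- If a measure dominated by `t • Q` has mass exceeding the truncated mass of `P` at level `t`,
then it puts more mass than `P` does on some strict sublevel set of the density of `P`. -/
theorem exists_sublevel_measure_lt {Ω : Type} [MeasurableSpace Ω] (P Q S : Measure Ω)
    [IsFiniteMeasure P] [IsFiniteMeasure Q] {t : ℝ} (ht : 0 < t)
    (hS : S ≤ ENNReal.ofReal t • Q)
    (hlt : ∫⁻ y, min (P.rnDeriv Q y) (ENNReal.ofReal t) ∂Q < S Set.univ) :
    ∃ t' : ℝ, 0 < t' ∧ t' < t ∧ ∃ N : Set Ω, MeasurableSet N ∧ Q Nᶜ = 0 ∧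
      P ({y | P.rnDeriv Q y < ENNReal.ofReal t} ∩ N) <
        S ({y | P.rnDeriv Q y < ENNReal.ofReal t'} ∩ N) := by
  set r := P.rnDeriv Q with hr
  have hrm : Measurable r := P.measurable_rnDeriv Q
  set T := ENNReal.ofReal t with hT
  set hms := Measure.mutuallySingular_singularPart P Q
  set N := hms.nullSet
  have hNm : MeasurableSet N := hms.measurableSet_nullSet
  have hQN : Q Nᶜ = 0 := hms.measure_compl_nullSet
  have hPN : P.singularPart Q N = 0 := hms.measure_nullSet
  set A : Set Ω := {y | r y < T} ∩ N with hA
  have hAm : MeasurableSet A := (measurableSet_lt hrm measurable_const).inter hNm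
  have hPA : P A = ∫⁻ y in A, r y ∂Q := by
    conv_lhs => rw [← Measure.singularPart_add_rnDeriv P Q]
    rw [Measure.add_apply, measure_mono_null Set.inter_subset_right hPN, zero_add,
      withDensity_apply _ hAm]
  have hmin : ∫⁻ y, min (r y) T ∂Q = P A + T * Q Aᶜ := by
    rw [← lintegral_add_compl _ hAm, hPA, ← setLIntegral_const]
    congr 1
    · refine setLIntegral_congr_fun hAm fun y hy => min_eq_left hy.1.le
    · refine setLIntegral_congr_fun_ae hAm.compl ?_
      have : ∀ᵐ y ∂Q, y ∈ N := by rw [ae_iff]; exact hQN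
      filter_upwards [this] with y hy hyA
      refine min_eq_right ?_
      by_contra hcon
      exact hyA ⟨not_le.1 hcon, hy⟩
  have hSA : P A < S A := by
    by_contra hcon
    refine hlt.not_ge ?_
    rw [hmin, ← measure_add_measure_compl hAm]
    exact add_le_add (not_lt.1 hcon) (hS _)
  obtain ⟨u, hum, hut, hulim⟩ := exists_seq_strictMono_tendsto t
  set An : ℕ → Set Ω := fun n => {y | r y < ENNReal.ofReal (u n)} ∩ N with hAn
  have hmono : Monotone An := fun n m hnm =>
    Set.inter_subset_inter_left _ fun y (hy : r y < _) =>
      lt_of_lt_of_le hy (ENNReal.ofReal_le_ofReal (hum.monotone hnm))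
  have hunion : ⋃ n, An n = A := by
    ext y
    simp only [Set.mem_iUnion, hAn, hA, Set.mem_inter_iff, Set.mem_ofPred_eq]
    constructor
    · rintro ⟨n, h, hN⟩
      exact ⟨h.trans_le (ENNReal.ofReal_le_ofReal (hut n).le), hN⟩
    · rintro ⟨h, hN⟩
      obtain ⟨n, hn⟩ := ((ENNReal.tendsto_ofReal hulim).eventually (lt_mem_nhds h)).exists
      exact ⟨n, hn, hN⟩
  have hlim := tendsto_measure_iUnion_atTop (μ := S) hmono
  rw [hunion] at hlim
  obtain ⟨n, hn1, hn2⟩ := ((hlim.eventually (lt_mem_nhds hSA)).and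
    (hulim.eventually (lt_mem_nhds ht))).exists
  exact ⟨u n, hn2, hut n, N, hNm, hQN, hn1⟩

/-- Mass exchange: if `σ` puts more mass on `A'` than `π` does outside `B`, a fraction of the mass
that `π` sends to `B` can be rerouted along `σ` to `A'`. -/
theorem exists_plan_exchange {E : Set (X × Y)} {νX : Measure X} [IsFiniteMeasure νX]
    {π σ : Measure (X × Y)} (hπ : π ∈ Plans E νX) [IsFiniteMeasure σ] (hσE : σ Eᶜ = 0)
    (hσX : σ.map Prod.fst ≤ νX) {A' B : Set Y} (hA' : MeasurableSet A') (hB : MeasurableSet B)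
    (hlt : (π.map Prod.snd) Bᶜ < (σ.map Prod.snd) A') {ε : ℝ≥0∞} (hε : ε ≤ 1) :
    ∃ P₁ U V : Measure Y, IsFiniteMeasure P₁ ∧ V Set.univ ≠ 0 ∧
      V ≤ (σ.map Prod.snd).restrict A' ∧ U ≤ (π.map Prod.snd).restrict B ∧
      π.map Prod.snd = P₁ + ε • U ∧ ∃ π' ∈ Plans E νX, π'.map Prod.snd = P₁ + ε • V := by
  obtain ⟨hπf, hπE, hπX⟩ := hπ
  have density : ∀ μ : Measure (X × Y), IsFiniteMeasure μ → μ.map Prod.fst ≤ νX →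
      ∃ a : X → ℝ≥0∞, Measurable a ∧ (∀ x, a x ≤ 1) ∧ μ.map Prod.fst = νX.withDensity a := by
    intro μ hμ hle
    refine ⟨fun x => min ((μ.map Prod.fst).rnDeriv νX x) 1,
      (Measure.measurable_rnDeriv _ _).min measurable_const, fun x => min_le_right _ _, ?_⟩
    conv_lhs => rw [← Measure.withDensity_rnDeriv_eq _ _ hle.absolutelyContinuous]
    refine withDensity_congr_ae ?_
    filter_upwards [Measure.rnDeriv_le_one_of_le hle] with x hx
    exact (min_eq_left hx).symm
  set σA := σ.restrict (Prod.snd ⁻¹' A') with hσA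
  set πB := π.restrict (Prod.snd ⁻¹' B) with hπB
  obtain ⟨a, ham, ha1, ha⟩ := density σA inferInstance
    ((Measure.map_mono Measure.restrict_le_self measurable_fst).trans hσX)
  obtain ⟨b, hbm, hb1, hb⟩ := density πB inferInstance
    ((Measure.map_mono Measure.restrict_le_self measurable_fst).trans hπX.le)
  have hab : ∫⁻ x, a x * b x ∂νX ≠ 0 := by
    refine lintegral_mul_ne_zero_of_measure_univ_lt νX ham hbm ha1 hb1 ?_
    have h1 : ∫⁻ x, a x ∂νX = (σ.map Prod.snd) A' := by
      rw [← setLIntegral_univ, ← withDensity_apply _ MeasurableSet.univ, ← ha,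
        Measure.map_apply measurable_fst MeasurableSet.univ, hσA, Set.preimage_univ,
        Measure.restrict_apply_univ, Measure.map_apply measurable_snd hA']
    have h2 : ∫⁻ x, b x ∂νX = (π.map Prod.snd) B := by
      rw [← setLIntegral_univ, ← withDensity_apply _ MeasurableSet.univ, ← hb,
        Measure.map_apply measurable_fst MeasurableSet.univ, hπB, Set.preimage_univ,
        Measure.restrict_apply_univ, Measure.map_apply measurable_snd hB]
    have h3 : νX Set.univ = (π.map Prod.snd) Bᶜ + (π.map Prod.snd) B := by
      rw [add_comm, measure_add_measure_compl hB, ← hπX,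
        Measure.map_apply measurable_fst MeasurableSet.univ,
        Measure.map_apply measurable_snd MeasurableSet.univ, Set.preimage_univ, Set.preimage_univ]
    rw [h1, h2, h3]
    exact ENNReal.add_lt_add_right (measure_ne_top _ _) hlt
  set τ := σA.withDensity fun z => b z.1 with hτ
  set υ := πB.withDensity fun z => a z.1 with hυ
  have hτle : τ ≤ σA := withDensity_le_self _ fun z => hb1 z.1
  have hυle : υ ≤ πB := withDensity_le_self _ fun z => ha1 z.1
  have hτf : IsFiniteMeasure τ := isFiniteMeasure_of_le _ hτle
  have hτX : τ.map Prod.fst = νX.withDensity (a * b) := by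
    rw [hτ, Measure.map_withDensity_comp _ measurable_fst hbm, ha, withDensity_mul _ ham hbm]
  have hυX : υ.map Prod.fst = νX.withDensity (a * b) := by
    rw [hυ, Measure.map_withDensity_comp _ measurable_fst ham, hb, mul_comm a b,
      withDensity_mul _ hbm ham]
  have hευ : ε • υ ≤ π := by
    refine le_trans ?_ (hυle.trans Measure.restrict_le_self)
    intro s
    simpa using mul_le_mul_left hε (υ s)
  have hευf : IsFiniteMeasure (ε • υ) := isFiniteMeasure_of_le _ hευ
  have hετf : IsFiniteMeasure (ε • τ) :=
    Measure.smul_finite _ (ne_top_of_le_ne_top ENNReal.one_ne_top hε)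
  set π₁ := π - ε • υ with hπ₁
  have hsum : π₁ + ε • υ = π := Measure.sub_add_cancel_of_le hευ
  have hπ₁le : π₁ ≤ π := Measure.sub_le
  refine ⟨π₁.map Prod.snd, υ.map Prod.snd, τ.map Prod.snd, inferInstance, ?_, ?_, ?_, ?_,
    π₁ + ε • τ, ⟨inferInstance, ?_, ?_⟩, ?_⟩
  · rw [Measure.map_apply measurable_snd MeasurableSet.univ, Set.preimage_univ,
      ← Set.preimage_univ (f := Prod.fst), ← Measure.map_apply measurable_fst MeasurableSet.univ,
      hτX, withDensity_apply _ MeasurableSet.univ, setLIntegral_univ]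
    exact hab
  · rw [Measure.restrict_map measurable_snd hA']
    exact Measure.map_mono hτle measurable_snd
  · rw [Measure.restrict_map measurable_snd hB]
    exact Measure.map_mono hυle measurable_snd
  · rw [← Measure.map_smul, ← Measure.map_add _ _ measurable_snd, hsum]
  · have h1 : π₁ Eᶜ = 0 := Measure.absolutelyContinuous_of_le hπ₁le hπE
    have h2 : τ Eᶜ = 0 :=
      Measure.absolutelyContinuous_of_le (hτle.trans Measure.restrict_le_self) hσE
    simp [h1, h2]
  · rw [Measure.map_add _ _ measurable_fst, Measure.map_smul, hτX, ← hυX, ← Measure.map_smul,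
      ← Measure.map_add _ _ measurable_fst, hsum, hπX]
  · rw [Measure.map_add _ _ measurable_snd, Measure.map_smul]

theorem ENNStrictConvexOn.lt_of_lt_of_le_zero {f : ℝ → ℝ≥0∞} (hf : ENNStrictConvexOn (Set.Ici 0) f)
    {c : ℝ} (hc : f c = 0) (hpos : ∀ x, 0 ≤ x → x ≠ c → f x ≠ 0) {x x' : ℝ} (hx : 0 ≤ x)
    (hxx' : x < x') (hx'c : x' ≤ c) (hfin : f x ≠ ⊤) : f x' < f x := by
  have hxc : x < c := hxx'.trans_le hx'c
  rcases hx'c.eq_or_lt with rfl | hlt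
  · rw [hc]; exact pos_iff_ne_zero.2 (hpos x hx hxc.ne)
  have hcx : 0 < c - x := sub_pos.2 hxc
  have h := hf x hx c (hx.trans hxc.le) hxc hfin (by rw [hc]; exact ENNReal.zero_ne_top)
    ((c - x') / (c - x)) ((x' - x) / (c - x)) (div_pos (sub_pos.2 hlt) hcx)
    (div_pos (sub_pos.2 hxx') hcx) (by field_simp; ring)
  have he : (c - x') / (c - x) * x + (x' - x) / (c - x) * c = x' := by field_simp; ring
  rw [he, hc, mul_zero, add_zero] at h
  refine h.trans_le (mul_le_of_le_one_left' ?_)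
  rw [ENNReal.ofReal_le_one, div_le_one hcx]
  linarith

theorem ENNStrictConvexOn.le_of_zero_le_of_le {f : ℝ → ℝ≥0∞} (hf : ENNStrictConvexOn (Set.Ici 0) f)
    {c : ℝ} (hc0 : 0 ≤ c) (hc : f c = 0) {x x' : ℝ} (hcx' : c ≤ x') (hx'x : x' ≤ x) :
    f x' ≤ f x := by
  rcases eq_or_ne (f x) ⊤ with htop | hfin
  · rw [htop]; exact le_top
  rcases hcx'.eq_or_lt with rfl | hlt
  · rw [hc]; exact zero_le
  rcases hx'x.eq_or_lt with rfl | hlt'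
  · exact le_rfl
  have hcx : 0 < x - c := sub_pos.2 (hlt.trans hlt')
  have h := hf c hc0 x (hc0.trans (hlt.trans hlt').le) (hlt.trans hlt')
    (by rw [hc]; exact ENNReal.zero_ne_top) hfin
    ((x - x') / (x - c)) ((x' - c) / (x - c)) (div_pos (sub_pos.2 hlt') hcx)
    (div_pos (sub_pos.2 hlt) hcx) (by field_simp; ring)
  have he : (x - x') / (x - c) * c + (x' - c) / (x - c) * x = x' := by field_simp; ring
  rw [he, hc, mul_zero, zero_add] at h
  refine h.le.trans (mul_le_of_le_one_left' ?_)
  rw [ENNReal.ofReal_le_one, div_le_one hcx]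
  linarith

/-- Raising the small values and lowering the large values of a density towards a level `c`
strictly decreases a strictly convex divergence. -/
theorem thetaDiv_lt_of_density_exchange {Ω : Type} [MeasurableSpace Ω] {θ : ℝ → EReal}
    (hθ : ProperConvexLSCOn θ) (hs : StrictlyConvexOnDom θ) {P P' Q : Measure Ω}
    [IsFiniteMeasure P] [IsFiniteMeasure P'] [IsFiniteMeasure Q]
    (hmass : P' Set.univ = P Set.univ) (hfin : thetaDiv θ P Q ≠ ⊤) {t' c t : ℝ} (htc' : t' < c)
    (hct : c < t)
    (hsing : P'.singularPart Q Set.univ ≤ P.singularPart Q Set.univ)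
    (hden : ∀ᵐ y ∂Q,
      ((P.rnDeriv Q y).toReal < t' ∧ (P.rnDeriv Q y).toReal ≤ (P'.rnDeriv Q y).toReal ∧
        (P'.rnDeriv Q y).toReal ≤ c) ∨
      ((P.rnDeriv Q y).toReal < t ∧ (P'.rnDeriv Q y).toReal = (P.rnDeriv Q y).toReal) ∨
      (t ≤ (P.rnDeriv Q y).toReal ∧ c ≤ (P'.rnDeriv Q y).toReal ∧
        (P'.rnDeriv Q y).toReal ≤ (P.rnDeriv Q y).toReal))
    (hlow : Q {y | (P.rnDeriv Q y).toReal < t' ∧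
      (P.rnDeriv Q y).toReal < (P'.rnDeriv Q y).toReal} ≠ 0) :
    thetaDiv θ P' Q < thetaDiv θ P Q := by
  set r := fun y => (P.rnDeriv Q y).toReal with hr
  set r' := fun y => (P'.rnDeriv Q y).toReal with hr'
  have hrm : Measurable r := (P.measurable_rnDeriv Q).ennreal_toReal
  have hr0 : ∀ y, 0 ≤ r y := fun y => ENNReal.toReal_nonneg
  have hdivfin : ∀ {f : ℝ → ℝ≥0∞} {s : ℝ≥0∞} {α β : ℝ}, Measurable f →
      (∀ x : ℝ, 0 ≤ x → θ x = (f x : EReal) + ((α * x + β : ℝ) : EReal)) →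
      recessionSlope θ = (s : EReal) + (α : EReal) → profileDiv f s P Q ≠ ⊤ := by
    intro f s α β hfm hfθ hsR h
    rw [thetaDiv_eq_profileDiv_add hfm hfθ hsR, h, EReal.coe_ennreal_top] at hfin
    exact hfin (EReal.top_add_coe _)
  obtain ⟨α₀, β₀, hαβ₀⟩ := hs.exists_minorant hθ
  obtain ⟨f₀, s₀, hf₀, hfθ₀, hsR₀⟩ := hs.exists_profile hθ hαβ₀
  have hfin₀ := hdivfin hf₀.measurable hfθ₀ hsR₀
  rw [profileDiv, Ne, ENNReal.add_eq_top, not_or] at hfin₀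
  have hdom : ∀ᵐ y ∂Q, θ (r y) ≠ ⊤ := by
    filter_upwards [ae_lt_top (hf₀.measurable.comp hrm) hfin₀.1] with y hy
    rw [hfθ₀ _ (hr0 y)]
    exact EReal.add_ne_top (by simpa using hy.ne) (EReal.coe_ne_top _)
  have exists_of : ∀ A : Set Ω, Q A ≠ 0 → ∃ y ∈ A, θ (r y) ≠ ⊤ := by
    intro A hA
    have := (frequently_ae_mem_iff.2 hA).and_eventually hdom
    obtain ⟨y, hy⟩ := this.exists
    exact ⟨y, hy⟩
  obtain ⟨y₁, hy₁, hθ₁⟩ := exists_of _ hlow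
  have hz₁ : r y₁ < t' := hy₁.1
  obtain ⟨z₂, hz₂, hθ₂⟩ : ∃ z, t ≤ z ∧ θ z ≠ ⊤ := by
    by_cases hhigh : Q {y | t ≤ r y} = 0
    · by_cases hsp : P.singularPart Q Set.univ = 0
      · exfalso
        have hsp' : P'.singularPart Q Set.univ = 0 := le_antisymm (hsp ▸ hsing) zero_le
        have hle : P.rnDeriv Q ≤ᵐ[Q] P'.rnDeriv Q := by
          have hnh : ∀ᵐ y ∂Q, ¬ t ≤ r y := by
            rw [ae_iff]; simpa only [not_not] using hhigh
          filter_upwards [hden, hnh, P.rnDeriv_lt_top Q, P'.rnDeriv_lt_top Q] with y hy hn h1 h2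
          rw [← ENNReal.toReal_le_toReal h1.ne h2.ne]
          rcases hy with h | h | h
          · exact h.2.1
          · exact h.2.ge
          · exact absurd h.1 hn
        have hmassP : ∀ R : Measure Ω, IsFiniteMeasure R → R.singularPart Q Set.univ = 0 →
            R Set.univ = ∫⁻ y, R.rnDeriv Q y ∂Q := by
          intro R _ hR
          conv_lhs => rw [← Measure.singularPart_add_rnDeriv R Q]
          rw [Measure.add_apply, hR, zero_add, withDensity_apply _ MeasurableSet.univ,
            setLIntegral_univ]
        have hlt : ∫⁻ y, P.rnDeriv Q y ∂Q < ∫⁻ y, P'.rnDeriv Q y ∂Q := by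
          refine lintegral_strict_mono_of_ae_le_of_ae_lt_on (P'.measurable_rnDeriv Q).aemeasurable
            ?_ hle hlow ?_
          · rw [← hmassP P inferInstance hsp]; exact measure_ne_top _ _
          · filter_upwards [P.rnDeriv_lt_top Q, P'.rnDeriv_lt_top Q] with y h1 h2 hy
            exact (ENNReal.toReal_lt_toReal h1.ne h2.ne).1 hy.2
        rw [← hmassP P inferInstance hsp, ← hmassP P' inferInstance hsp', hmass] at hlt
        exact lt_irrefl _ hlt
      · have hs₀ : s₀ ≠ ⊤ := by
          intro h
          rw [h, ENNReal.top_mul hsp] at hfin₀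
          exact hfin₀.2 rfl
        refine ⟨t, le_rfl, hs.ne_top_of_recessionSlope_ne_top hθ ?_ (hr0 y₁) hθ₁
          (by linarith)⟩
        rw [hsR₀]
        exact EReal.add_ne_top (by simpa using hs₀) (EReal.coe_ne_top _)
    · obtain ⟨y₂, hy₂, hθ₂⟩ := exists_of _ hhigh
      exact ⟨r y₂, hy₂, hθ₂⟩
  obtain ⟨α, β, hc, hαβ⟩ := hs.exists_touching_minorant hθ (hr0 y₁) hθ₁ hθ₂
    (c := c) (by linarith) (by linarith)
  obtain ⟨f, s, hf, hfθ, hsR⟩ := hs.exists_profile hθ fun x hx => (hαβ x hx).1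
  have hc0 : 0 ≤ c := by have := hr0 y₁; linarith
  have hfc : f c = 0 := by
    have h := hfθ c hc0
    have h' := (EReal.addLECancellable_coe (α * c + β)).inj_left.1
      (((zero_add _).trans hc.symm).trans h)
    exact_mod_cast h'.symm
  have hfpos : ∀ x, 0 ≤ x → x ≠ c → f x ≠ 0 := by
    intro x hx hxc h0
    have h := (hαβ x hx).2 hxc
    rw [hfθ x hx, h0] at h
    simp at h
  have hpfin := hdivfin hf.measurable hfθ hsR
  have hpf := hpfin
  rw [profileDiv, Ne, ENNReal.add_eq_top, not_or] at hpf
  have hffin : ∀ᵐ y ∂Q, f (r y) < ⊤ := ae_lt_top (hf.measurable.comp hrm) hpf.1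
  have hle : (fun y => f (r' y)) ≤ᵐ[Q] fun y => f (r y) := by
    filter_upwards [hden, hffin] with y hy hyf
    rcases hy with ⟨h1, h2, h3⟩ | ⟨h1, h2⟩ | ⟨h1, h2, h3⟩
    · rcases h2.eq_or_lt with h | h
      · exact (congrArg f h.symm).le
      · exact (hf.strict.lt_of_lt_of_le_zero hfc hfpos (hr0 y) h h3 hyf.ne).le
    · exact (congrArg f h2).le
    · exact hf.strict.le_of_zero_le_of_le hc0 hfc h2 h3
  have hint : ∫⁻ y, f (r' y) ∂Q < ∫⁻ y, f (r y) ∂Q := by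
    refine lintegral_strict_mono_of_ae_le_of_ae_lt_on (hf.measurable.comp hrm).aemeasurable
      (ne_top_of_le_ne_top hpf.1 (lintegral_mono_ae hle)) hle hlow ?_
    filter_upwards [hden, hffin] with y hy hyf hlt
    refine hf.strict.lt_of_lt_of_le_zero hfc hfpos (hr0 y) hlt.2 ?_ hyf.ne
    rcases hy with h | h | h
    · exact h.2.2
    · exact absurd h.2 hlt.2.ne'
    · exact absurd h.1 (by have := hlt.1; simp only [not_le]; linarith)
  have hprof : profileDiv f s P' Q < profileDiv f s P Q := by
    rw [profileDiv, profileDiv]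
    exact ENNReal.add_lt_add_of_lt_of_le (ne_top_of_le_ne_top hpf.2 (mul_le_mul_right hsing s))
      hint (mul_le_mul_right hsing s)
  have hm : P'.real Set.univ = P.real Set.univ := by rw [Measure.real, hmass]; rfl
  rw [thetaDiv_eq_profileDiv_add hf.measurable hfθ hsR,
    thetaDiv_eq_profileDiv_add hf.measurable hfθ hsR, hm]
  exact EReal.add_lt_add_right_coe (EReal.coe_ennreal_lt_coe_ennreal_iff.2 hprof) _

/-- If the opposite marginal of a plan minimizes the divergence to `νY`, then it attains the
maximal feasible mass at every level. -/
theorem fit_le_lintegral_min_rnDeriv {E : Set (X × Y)} {θ : ℝ → EReal}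
    (hθ : ProperConvexLSCOn θ) (hs : StrictlyConvexOnDom θ) {νX : Measure X} {νY : Measure Y}
    [IsFiniteMeasure νX] [IsFiniteMeasure νY] {π : Measure (X × Y)} (hπ : π ∈ Plans E νX)
    (hfin : thetaDiv θ (π.map Prod.snd) νY ≠ ⊤)
    (hopt : ∀ π' ∈ Plans E νX, thetaDiv θ (π.map Prod.snd) νY ≤ thetaDiv θ (π'.map Prod.snd) νY)
    {t : ℝ} (ht : 0 < t) :
    Fit E νX νY t ≤
      ∫⁻ y, min ((π.map Prod.snd).rnDeriv νY y) (ENNReal.ofReal t) ∂νY := by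
  refine iSup₂_le fun σ hσ => ?_
  obtain ⟨hσf, hσE, hσX, hσY⟩ := hσ
  have hπf : IsFiniteMeasure π := hπ.1
  set P := π.map Prod.snd with hP
  set S := σ.map Prod.snd with hS
  set r := P.rnDeriv νY with hr
  have hrm : Measurable r := P.measurable_rnDeriv νY
  by_contra hcon
  have hSuniv : S Set.univ = σ Set.univ := by
    rw [hS, Measure.map_apply measurable_snd MeasurableSet.univ, Set.preimage_univ]
  obtain ⟨t', ht'0, ht't, N, hNm, hQN, hPS⟩ := exists_sublevel_measure_lt P νY S ht hσY
    (by rw [hSuniv]; exact not_le.1 hcon)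
  set T := ENNReal.ofReal t with hT
  set A' : Set Y := {y | r y < ENNReal.ofReal t'} ∩ N with hA'
  set B : Set Y := ({y | r y < T} ∩ N)ᶜ with hB
  have hA'm : MeasurableSet A' := (measurableSet_lt hrm measurable_const).inter hNm
  have hBm : MeasurableSet B := ((measurableSet_lt hrm measurable_const).inter hNm).compl
  set e : ℝ := (t - t') / (2 * t) with he
  have he0 : 0 < e := div_pos (sub_pos.2 ht't) (by linarith)
  have het : e * t = (t - t') / 2 := by rw [he]; field_simp
  have he1 : e ≤ 1 := by rw [he, div_le_one (by linarith)]; linarith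
  set ε : ℝ≥0∞ := ENNReal.ofReal e with hε
  have hεtop : ε ≠ ⊤ := ENNReal.ofReal_ne_top
  obtain ⟨P₁, U, V, hP₁f, hV0, hVle, hUle, hPeq, π', hπ', hπ'eq⟩ :=
    exists_plan_exchange hπ hσE hσX hA'm hBm (by rw [hB, compl_compl]; exact hPS)
      (ENNReal.ofReal_le_one.2 he1)
  rw [← hP] at hPeq
  have hUf : IsFiniteMeasure U := isFiniteMeasure_of_le _ hUle
  have hVf : IsFiniteMeasure V := isFiniteMeasure_of_le _ hVle
  have hεUf : IsFiniteMeasure (ε • U) := Measure.smul_finite _ hεtop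
  have hεVf : IsFiniteMeasure (ε • V) := Measure.smul_finite _ hεtop
  have hπ'f : IsFiniteMeasure π' := hπ'.1
  have hTf : IsFiniteMeasure (T • νY) := Measure.smul_finite _ ENNReal.ofReal_ne_top
  have hVac : V ≪ νY := (Measure.absolutelyContinuous_of_le
    ((hVle.trans Measure.restrict_le_self).trans hσY)).trans Measure.smul_absolutelyContinuous
  set P' := π'.map Prod.snd with hP'
  have hmass : P' Set.univ = P Set.univ := by
    rw [hP', hP, Measure.map_apply measurable_snd MeasurableSet.univ,
      Measure.map_apply measurable_snd MeasurableSet.univ, Set.preimage_univ,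
      ← Set.preimage_univ (f := Prod.fst), ← Measure.map_apply measurable_fst MeasurableSet.univ,
      ← Measure.map_apply measurable_fst MeasurableSet.univ, hπ'.2.2, hπ.2.2]
  have hsing : P'.singularPart νY Set.univ ≤ P.singularPart νY Set.univ := by
    rw [hπ'eq, hPeq, Measure.singularPart_add, Measure.singularPart_add,
      Measure.singularPart_eq_zero_of_ac (hVac.smul_left ε), add_zero]
    exact le_self_add
  have hdr : r =ᵐ[νY] P₁.rnDeriv νY + ε • U.rnDeriv νY := by
    rw [hr, hPeq]
    refine (Measure.rnDeriv_add' _ _ _).trans (EventuallyEq.add EventuallyEq.rfl ?_)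
    exact Measure.rnDeriv_smul_left_of_ne_top' _ _ hεtop
  have hdr' : P'.rnDeriv νY =ᵐ[νY] P₁.rnDeriv νY + ε • V.rnDeriv νY := by
    rw [hπ'eq]
    refine (Measure.rnDeriv_add' _ _ _).trans (EventuallyEq.add EventuallyEq.rfl ?_)
    exact Measure.rnDeriv_smul_left_of_ne_top' _ _ hεtop
  have hdU : U.rnDeriv νY ≤ᵐ[νY] B.indicator r :=
    (Measure.rnDeriv_mono νY hUle).trans_eq (Measure.rnDeriv_restrict _ _ hBm)
  have hdV : V.rnDeriv νY ≤ᵐ[νY] A'.indicator fun _ => T := by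
    refine (Measure.rnDeriv_mono νY (hVle.trans (Measure.restrict_mono_measure hσY A'))).trans_eq
      ((Measure.rnDeriv_restrict _ _ hA'm).trans ?_)
    filter_upwards [Measure.rnDeriv_smul_left_of_ne_top' νY νY
      (ENNReal.ofReal_ne_top (r := t)), Measure.rnDeriv_self νY] with y h1 h2
    by_cases hy : y ∈ A'
    · rw [Set.indicator_of_mem hy, Set.indicator_of_mem hy, h1, Pi.smul_apply, h2, smul_eq_mul,
        mul_one]
    · rw [Set.indicator_of_notMem hy, Set.indicator_of_notMem hy]
  have hN : ∀ᵐ y ∂νY, y ∈ N := by rw [ae_iff]; exact hQN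
  have hreal : ∀ᵐ y ∂νY, ∃ r₁ u v : ℝ, 0 ≤ u ∧ v = (V.rnDeriv νY y).toReal ∧ 0 ≤ v ∧
      (r y).toReal = r₁ + e * u ∧ (P'.rnDeriv νY y).toReal = r₁ + e * v ∧ u ≤ (r y).toReal ∧
      v ≤ t ∧ ((r y).toReal < t → u = 0) ∧ (t' ≤ (r y).toReal → v = 0) := by
    filter_upwards [hdr, hdr', hdU, hdV, hN, P.rnDeriv_lt_top νY, P₁.rnDeriv_lt_top νY,
      U.rnDeriv_lt_top νY, V.rnDeriv_lt_top νY] with y h1 h2 h3 h4 hyN hr_top h1_top hu_top hv_top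
    refine ⟨(P₁.rnDeriv νY y).toReal, (U.rnDeriv νY y).toReal, (V.rnDeriv νY y).toReal,
      ENNReal.toReal_nonneg, rfl, ENNReal.toReal_nonneg, ?_, ?_, ?_, ?_, ?_, ?_⟩
    · rw [h1, Pi.add_apply, Pi.smul_apply, smul_eq_mul, ENNReal.toReal_add h1_top.ne
        (ENNReal.mul_ne_top hεtop hu_top.ne), ENNReal.toReal_mul, ENNReal.toReal_ofReal he0.le]
    · rw [h2, Pi.add_apply, Pi.smul_apply, smul_eq_mul, ENNReal.toReal_add h1_top.ne
        (ENNReal.mul_ne_top hεtop hv_top.ne), ENNReal.toReal_mul, ENNReal.toReal_ofReal he0.le]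
    · exact ENNReal.toReal_mono hr_top.ne (h3.trans (Set.indicator_le_self' (fun _ _ => zero_le) y))
    · rw [← ENNReal.toReal_ofReal ht.le]
      exact ENNReal.toReal_mono ENNReal.ofReal_ne_top
        (h4.trans (Set.indicator_le_self' (fun _ _ => zero_le) y))
    · intro hlt
      have hyB : y ∉ B := by
        rw [hB, Set.notMem_compl_iff]
        exact ⟨(ENNReal.lt_ofReal_iff_toReal_lt hr_top.ne).2 hlt, hyN⟩
      rw [Set.indicator_of_notMem hyB] at h3
      rw [le_antisymm h3 zero_le, ENNReal.toReal_zero]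
    · intro hle
      have hyA : y ∉ A' := fun hy =>
        hle.not_gt ((ENNReal.lt_ofReal_iff_toReal_lt hr_top.ne).1 hy.1)
      rw [Set.indicator_of_notMem hyA] at h4
      rw [le_antisymm h4 zero_le, ENNReal.toReal_zero]
  refine (hopt π' hπ').not_gt (thetaDiv_lt_of_density_exchange hθ hs hmass hfin (t' := t')
    (c := (t + t') / 2) (t := t) (by linarith) (by linarith) hsing ?_ ?_)
  · filter_upwards [hreal] with y hy
    obtain ⟨r₁, u, v, hu0, -, hv0, h1, h2, hur, hvt, hu, hv⟩ := hy
    rw [h2]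
    change (r y).toReal < t' ∧ (r y).toReal ≤ _ ∧ _ ∨ (r y).toReal < t ∧ _ = (r y).toReal ∨
      t ≤ (r y).toReal ∧ _ ∧ _ ≤ (r y).toReal
    rcases lt_or_ge (r y).toReal t' with hlt | hge
    · left
      have := hu (hlt.trans ht't)
      subst this
      refine ⟨hlt, ?_, ?_⟩ <;> nlinarith
    rcases lt_or_ge (r y).toReal t with hlt | hge'
    · right; left
      have := hu hlt
      have := hv hge
      subst_vars
      exact ⟨hlt, by linarith⟩
    · right; right
      have := hv hge
      subst this
      refine ⟨hge', ?_, ?_⟩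
      · nlinarith
      · nlinarith
  · intro h0
    have hv0 : ∀ᵐ y ∂νY, V.rnDeriv νY y = 0 := by
      have h0' := measure_eq_zero_iff_ae_notMem.1 h0
      filter_upwards [hreal, h0', V.rnDeriv_lt_top νY] with y hy hy' hv_top
      obtain ⟨r₁, u, v, hu0, hveq, hv0, h1, h2, hur, hvt, hu, hv⟩ := hy
      by_contra hne
      have hvpos : 0 < v := by rw [hveq]; exact ENNReal.toReal_pos hne hv_top.ne
      have hlt : (r y).toReal < t' := by
        by_contra hge
        exact hvpos.ne' (hv (not_lt.1 hge))
      refine hy' ⟨hlt, ?_⟩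
      have hu' := hu (hlt.trans ht't)
      change (r y).toReal < _
      rw [h1, h2, hu']
      nlinarith [mul_pos he0 hvpos]
    refine hV0 ?_
    rw [← Measure.withDensity_rnDeriv_eq _ _ hVac, withDensity_apply _ MeasurableSet.univ,
      setLIntegral_univ, lintegral_congr_ae hv0, lintegral_zero]

end LevelOptimality

theorem strict_convex_closest_pair_induces_canonical_pair
    [TopologicalSpace X] [PolishSpace X] [BorelSpace X]
    [TopologicalSpace Y] [PolishSpace Y] [BorelSpace Y]
    (E : Set (X × Y)) (hE : IsClosed E)
    (νX : Measure X) (νY : Measure Y) [IsFiniteMeasure νX] [IsFiniteMeasure νY]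
    (hνX : 0 < νX Set.univ) (hνY : 0 < νY Set.univ)
    (hNbhdX : ∀ x : X, ∃ y : Y, (x, y) ∈ E) (hNbhdY : ∀ y : Y, ∃ x : X, (x, y) ∈ E)
    (θ : ℝ → EReal) (hθ : ProperConvexLSCOn θ) (hθstrict : StrictlyConvexOnDom θ)
    (πι πῑ : Measure (X × Y)) (hπι : πι ∈ Plans E νX) (hπῑ : πῑ ∈ PlansSnd E νY)
    (hmin : thetaDiv θ πι πῑ
        = sInf {d : EReal | ∃ ρι ∈ Plans E νX, ∃ ρῑ ∈ PlansSnd E νY, d = thetaDiv θ ρι ρῑ})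
    (hfin : thetaDiv θ πι πῑ ≠ ⊤) :
    LevelOptMaximin E νX νY πι ∧ IsPropResponse E νY πι πῑ := by
  have hX : Nonempty X := by
    by_contra hempty
    rw [not_nonempty_iff] at hempty
    exact hνX.ne' (by rw [Set.univ_eq_empty_iff.2 hempty, measure_empty])
  have key : ∀ π' ∈ Plans E νX, thetaDiv θ πι πῑ ≤ thetaDiv θ (π'.map Prod.snd) νY := by
    intro π' hπ'
    obtain ⟨ρ', hρ', h⟩ := exists_plansSnd_thetaDiv_eq hE.measurableSet hθ hπ' hπῑ
    rw [hmin]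
    exact sInf_le ⟨π', hπ', ρ', hρ', h.symm⟩
  obtain ⟨hprop, heq⟩ :=
    isPropResponse_of_thetaDiv_le hE.measurableSet hθ hθstrict hπι hπῑ hfin (key πι hπι)
  exact ⟨fun t ht => le_antisymm (lintegral_min_rnDeriv_le_fit hπι t)
    (fit_le_lintegral_min_rnDeriv hθ hθstrict hπι (heq ▸ hfin) (fun π' h => heq ▸ key π' h) ht),
    hprop⟩
end
end
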